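/- arXiv:1211.0044 — 3 statements merged into one kernel-verified Lean document; each statement's English description precedes it below -/
import Mathlib

section
/- If F is analytic in a complex neighborhood of ℝ, locally injective on ℝ (every real point has an open real interval around it on which F is injective), and the set {(a,b) ∈ ℝ² : a ≠ b and F(a) = F(b)} is uncountable, then F(ℝ) is a loop in ℂ, i.e., the image of a continuous map L : [γ,δ] → ℂ with L(γ) = L(δ). -/
open Set

open Filter Topology

/-- Near `p`, points of `D` are ordered the same way by both coordinates. -/
def IncreasingAt (D : Set (ℝ × ℝ)) (p : ℝ × ℝ) : Prop :=
  ∃ V ∈ 𝓝 p, ∀ q ∈ V, ∀ r ∈ V, q ∈ D → r ∈ D → q.1 < r.1 → q.2 < r.2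

/-- Near `p`, points of `D` are ordered oppositely by the two coordinates. -/
def DecreasingAt (D : Set (ℝ × ℝ)) (p : ℝ × ℝ) : Prop :=
  ∃ V ∈ 𝓝 p, ∀ q ∈ V, ∀ r ∈ V, q ∈ D → r ∈ D → q.1 < r.1 → r.2 < q.2

/-- A closed subset of the plane, disjoint from the diagonal, which near each of its points is
monotone and extends to both sides of that point. -/
structure IsMonotoneCurve (D : Set (ℝ × ℝ)) : Prop where
  isClosed : IsClosed D
  fst_ne_snd : ∀ p ∈ D, p.1 ≠ p.2
  monotone : ∀ p ∈ D, IncreasingAt D p ∨ DecreasingAt D p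
  frequently_lt : ∀ p ∈ D, ∃ᶠ q in 𝓝[D] p, p.1 < q.1
  frequently_gt : ∀ p ∈ D, ∃ᶠ q in 𝓝[D] p, q.1 < p.1

lemma IncreasingAt.eventually {D : Set (ℝ × ℝ)} {p : ℝ × ℝ} (h : IncreasingAt D p) :
    ∀ᶠ q in 𝓝 p, IncreasingAt D q := by
  obtain ⟨V, hV, h⟩ := h
  filter_upwards [eventually_mem_nhds_iff.2 hV] with q hq using ⟨V, hq, h⟩

lemma DecreasingAt.eventually {D : Set (ℝ × ℝ)} {p : ℝ × ℝ} (h : DecreasingAt D p) :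
    ∀ᶠ q in 𝓝 p, DecreasingAt D q := by
  obtain ⟨V, hV, h⟩ := h
  filter_upwards [eventually_mem_nhds_iff.2 hV] with q hq using ⟨V, hq, h⟩

namespace IsMonotoneCurve

variable {D : Set (ℝ × ℝ)} {p : ℝ × ℝ}

lemma neg (hD : IsMonotoneCurve D) : IsMonotoneCurve (-D) := by
  have hneg (p : ℝ × ℝ) : Tendsto (fun q : ℝ × ℝ ↦ -q) (𝓝[D] (-p)) (𝓝[-D] p) := by
    refine tendsto_nhdsWithin_iff.2 ⟨?_, ?_⟩
    · have : Tendsto (fun q : ℝ × ℝ ↦ -q) (𝓝 (-p)) (𝓝 (- -p)) := continuous_neg.tendsto _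
      rw [neg_neg] at this
      exact this.mono_left nhdsWithin_le_nhds
    · filter_upwards [self_mem_nhdsWithin] with q hq
      simpa using hq
  have hmem {V : Set (ℝ × ℝ)} {p : ℝ × ℝ} (hV : V ∈ 𝓝 (-p)) : -V ∈ 𝓝 p :=
    (continuous_neg.tendsto p) hV
  refine ⟨hD.isClosed.preimage continuous_neg, fun p hp ↦ ?_, fun p hp ↦ ?_, fun p hp ↦ ?_,
    fun p hp ↦ ?_⟩
  · simpa using hD.fst_ne_snd _ hp
  · refine (hD.monotone _ hp).imp ?_ ?_
    all_goals
      rintro ⟨V, hV, h⟩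
      refine ⟨-V, hmem hV, fun q hq r hr hqD hrD hqr ↦ ?_⟩
      simpa using h _ hr _ hq hrD hqD (by simpa using hqr)
  · refine (hneg p).frequently ((hD.frequently_gt _ hp).mono fun q hq ↦ ?_)
    simp only [Prod.fst_neg] at hq ⊢
    linarith
  · refine (hneg p).frequently ((hD.frequently_lt _ hp).mono fun q hq ↦ ?_)
    simp only [Prod.fst_neg] at hq ⊢
    linarith

lemma not_increasingAt (hD : IsMonotoneCurve D) (hp : p ∈ D) (h : DecreasingAt D p) :
    ¬ IncreasingAt D p := by
  rintro ⟨V, hV, hinc⟩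
  obtain ⟨W, hW, hdec⟩ := h
  obtain ⟨q, hpq, hqD, hqV, hqW⟩ := ((hD.frequently_lt p hp).and_eventually
    (eventually_mem_nhdsWithin.and
      (nhdsWithin_le_nhds (inter_mem hV hW)))).exists
  exact lt_asymm (hinc _ (mem_of_mem_nhds hV) _ hqV hp hqD hpq)
    (hdec _ (mem_of_mem_nhds hW) _ hqW hp hqD hpq)

lemma not_decreasingAt_of_fst_lt_snd (hD : IsMonotoneCurve D) (hp : p ∈ D) (hlt : p.1 < p.2) :
    ¬ DecreasingAt D p := by
  intro hdec
  obtain ⟨a, b⟩ := p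
  simp only at hlt
  let K : Set (ℝ × ℝ) :=
    (Icc a b ×ˢ Icc a b) ∩ (D ∩ {q | ¬ IncreasingAt D q} ∩ {q | q.1 ≤ q.2})
  have hK : IsCompact K := by
    refine (isCompact_Icc.prod isCompact_Icc).inter_right ((hD.isClosed.inter ?_).inter
      (isClosed_le continuous_fst continuous_snd))
    rw [← isOpen_compl_iff, isOpen_iff_eventually]
    intro q hq
    simp only [mem_compl_iff, mem_ofPred_eq, not_not] at hq ⊢
    exact hq.eventually
  have hG : IsClosed (Prod.fst '' K) := (hK.image continuous_fst).isClosed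
  have hsub : Icc a b ⊆ Prod.fst '' K := by
    refine (hG.inter isClosed_Icc).Icc_subset_of_forall_exists_gt
      ⟨(a, b), ⟨⟨⟨le_rfl, hlt.le⟩, hlt.le, le_rfl⟩, ⟨hp, hD.not_increasingAt hp hdec⟩, hlt.le⟩,
        rfl⟩ ?_
    rintro _ ⟨⟨⟨x, s⟩, ⟨⟨hx, hs⟩, ⟨hxD, hninc⟩, hxs⟩, rfl⟩, -, hxb⟩ y hy
    simp only [mem_ofPred_eq, mem_Ioi] at hx hs hxs hy hxb
    have hd : DecreasingAt D (x, s) := (hD.monotone _ hxD).resolve_left hninc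
    have hlt' : x < s := lt_of_le_of_ne hxs (hD.fst_ne_snd _ hxD)
    have h1 : ∀ᶠ q : ℝ × ℝ in 𝓝 (x, s), q.1 < y :=
      continuous_fst.continuousAt.eventually_lt continuousAt_const hy
    have h2 : ∀ᶠ q : ℝ × ℝ in 𝓝 (x, s), q.1 < q.2 :=
      continuous_fst.continuousAt.eventually_lt continuous_snd.continuousAt hlt'
    have h3 := hd.eventually
    obtain ⟨V, hV, hVd⟩ := hd
    obtain ⟨q, hq, hqD, hq1, hq2, hq3, hqV⟩ := ((hD.frequently_lt _ hxD).and_eventually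
      (eventually_mem_nhdsWithin.and
        (nhdsWithin_le_nhds (h1.and (h2.and (h3.and hV)))))).exists
    simp only at hq
    have hqs : q.2 < s := hVd _ (mem_of_mem_nhds hV) _ hqV hxD hqD hq
    have ha := hx.1
    have hb := hs.2
    exact ⟨q.1, ⟨q, ⟨⟨⟨by linarith, by linarith⟩, by linarith, by linarith⟩,
      ⟨hqD, hD.not_increasingAt hqD hq3⟩, hq2.le⟩, rfl⟩, hq, hq1.le⟩
  obtain ⟨⟨x, s⟩, ⟨⟨-, hs⟩, ⟨hxD, -⟩, hxs⟩, rfl⟩ := hsub ⟨hlt.le, le_rfl⟩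
  exact hD.fst_ne_snd _ hxD (le_antisymm hxs hs.2)

lemma increasingAt (hD : IsMonotoneCurve D) (hp : p ∈ D) : IncreasingAt D p := by
  refine (hD.monotone p hp).resolve_right fun hdec ↦ ?_
  rcases (hD.fst_ne_snd p hp).lt_or_gt with h | h
  · exact hD.not_decreasingAt_of_fst_lt_snd hp h hdec
  · refine hD.neg.not_decreasingAt_of_fst_lt_snd (p := -p) (by simpa using hp) (by simpa using h) ?_
    obtain ⟨V, hV, hdec⟩ := hdec
    refine ⟨-V, continuous_neg.tendsto (-p) (by simpa using hV), fun q hq r hr hqD hrD hqr ↦ ?_⟩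
    simpa using hdec _ hr _ hq hrD hqD (by simpa using hqr)

/-- A monotone curve through a point below the diagonal continues below the diagonal over every
larger abscissa. -/
lemma exists_mem_of_ge (hD : IsMonotoneCurve D) (hp : p ∈ D) (hlt : p.2 < p.1) {T : ℝ}
    (hT : p.1 ≤ T) : ∃ s ∈ Ico p.2 T, (T, s) ∈ D := by
  obtain ⟨a, b⟩ := p
  simp only at hlt hT ⊢
  let K : Set (ℝ × ℝ) := (Icc a T ×ˢ Icc b T) ∩ (D ∩ {q | q.2 ≤ q.1})
  have hK : IsCompact K := (isCompact_Icc.prod isCompact_Icc).inter_right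
    (hD.isClosed.inter (isClosed_le continuous_snd continuous_fst))
  have hG : IsClosed (Prod.fst '' K) := (hK.image continuous_fst).isClosed
  have hsub : Icc a T ⊆ Prod.fst '' K := by
    refine (hG.inter isClosed_Icc).Icc_subset_of_forall_exists_gt
      ⟨(a, b), ⟨⟨⟨le_rfl, hT⟩, le_rfl, hlt.le.trans hT⟩, hp, hlt.le⟩, rfl⟩ ?_
    rintro _ ⟨⟨⟨x, s⟩, ⟨⟨hx, hs⟩, hxD, hxs⟩, rfl⟩, -, hxT⟩ y hy
    simp only [mem_ofPred_eq, mem_Ioi] at hx hs hxs hy hxT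
    have hlt' : s < x := lt_of_le_of_ne hxs (hD.fst_ne_snd _ hxD).symm
    have h1 : ∀ᶠ q : ℝ × ℝ in 𝓝 (x, s), q.1 < y :=
      continuous_fst.continuousAt.eventually_lt continuousAt_const hy
    have h2 : ∀ᶠ q : ℝ × ℝ in 𝓝 (x, s), q.2 < q.1 :=
      continuous_snd.continuousAt.eventually_lt continuous_fst.continuousAt hlt'
    have h3 : ∀ᶠ q : ℝ × ℝ in 𝓝 (x, s), q.1 < T :=
      continuous_fst.continuousAt.eventually_lt continuousAt_const hxT
    obtain ⟨V, hV, hVi⟩ := hD.increasingAt hxD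
    obtain ⟨q, hq, hqD, hq1, hq2, hq3, hqV⟩ := ((hD.frequently_lt _ hxD).and_eventually
      (eventually_mem_nhdsWithin.and
        (nhdsWithin_le_nhds (h1.and (h2.and (h3.and hV)))))).exists
    simp only at hq
    have hqs : s < q.2 := hVi _ (mem_of_mem_nhds hV) _ hqV hxD hqD hq
    have ha := hx.1
    have hb := hs.1
    exact ⟨q.1, ⟨q, ⟨⟨⟨by linarith, by linarith⟩, by linarith, by linarith⟩,
      hqD, hq2.le⟩, rfl⟩, hq, hq1.le⟩
  obtain ⟨⟨x, s⟩, ⟨⟨-, hs⟩, hxD, hxs⟩, rfl⟩ := hsub ⟨hT, le_rfl⟩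
  exact ⟨s, ⟨hs.1, lt_of_le_of_ne hxs (hD.fst_ne_snd _ hxD).symm⟩, hxD⟩

lemma mem_image_Icc_of_ge {X : Type*} [TopologicalSpace X] [T2Space X] {f : ℝ → X}
    (hf : Continuous f) (hD : IsMonotoneCurve D)
    (hfD : ∀ q ∈ D, f q.1 = f q.2) (hp : p ∈ D) (hlt : p.2 < p.1) {T : ℝ} (hT : p.1 ≤ T) :
    f T ∈ f '' Icc p.2 p.1 := by
  have hc : IsCompact (Icc p.2 T ∩ {u | f u = f T}) :=
    isCompact_Icc.inter_right (isClosed_eq hf continuous_const)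
  obtain ⟨u, ⟨hu, hfu⟩, hmin⟩ := hc.exists_isLeast ⟨T, ⟨hlt.le.trans hT, le_rfl⟩, rfl⟩
  refine ⟨u, ⟨hu.1, ?_⟩, hfu⟩
  by_contra! hpu
  obtain ⟨s, hs, hsD⟩ := hD.exists_mem_of_ge hp hlt hpu.le
  exact hs.2.not_ge (hmin ⟨⟨hs.1, hs.2.le.trans hu.2⟩, (hfD _ hsD).symm.trans hfu⟩)

lemma range_eq_image_Icc {X : Type*} [TopologicalSpace X] [T2Space X] {f : ℝ → X}
    (hf : Continuous f) (hD : IsMonotoneCurve D) (hfD : ∀ q ∈ D, f q.1 = f q.2)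
    (hp : p ∈ D) (hps : p.swap ∈ D) (hlt : p.2 < p.1) :
    range f = f '' Icc p.2 p.1 := by
  refine subset_antisymm ?_ (image_subset_range _ _)
  rintro _ ⟨T, rfl⟩
  rcases le_or_gt p.1 T with h1 | h1
  · exact hD.mem_image_Icc_of_ge hf hfD hp hlt h1
  rcases le_or_gt p.2 T with h2 | h2
  · exact ⟨T, ⟨h2, h1.le⟩, rfl⟩
  · obtain ⟨u, hu, hfu⟩ := hD.neg.mem_image_Icc_of_ge (f := fun t ↦ f (-t)) (p := -p.swap)
      (T := -T) (hf.comp continuous_neg) (fun q hq ↦ hfD _ hq) (by simpa using hps)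
      (by simpa using hlt) (by simpa using h2.le)
    simp only [neg_neg] at hfu
    refine ⟨-u, ?_, hfu⟩
    simp only [Prod.snd_neg, Prod.fst_neg, Prod.snd_swap, Prod.fst_swap, mem_Icc] at hu ⊢
    constructor <;> linarith [hu.1, hu.2]

end IsMonotoneCurve

/-- A nonvanishing analytic germ has an analytic `n`-th root. -/
lemma AnalyticAt.exists_pow_eq {h : ℂ → ℂ} {z₀ : ℂ} (hh : AnalyticAt ℂ h z₀) (h0 : h z₀ ≠ 0)
    {n : ℕ} (hn : n ≠ 0) :
    ∃ r : ℂ → ℂ, AnalyticAt ℂ r z₀ ∧ r z₀ ≠ 0 ∧ ∀ z, r z ^ n = h z := by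
  have hpow : ∀ z, (h z₀ ^ (n⁻¹ : ℂ) * (h z / h z₀) ^ (n⁻¹ : ℂ)) ^ n = h z := fun z ↦ by
    rw [mul_pow, Complex.cpow_nat_inv_pow _ hn, Complex.cpow_nat_inv_pow _ hn,
      mul_div_cancel₀ _ h0]
  refine ⟨fun z ↦ h z₀ ^ (n⁻¹ : ℂ) * (h z / h z₀) ^ (n⁻¹ : ℂ), ?_, fun h' ↦ h0 ?_, hpow⟩
  · refine analyticAt_const.mul ((hh.div analyticAt_const h0).cpow analyticAt_const ?_)
    simp [div_self h0]
  · rw [← hpow z₀]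
    simp only at h'
    rw [h', zero_pow hn]

/-- An analytic germ that takes real values at real points accumulating at `0` takes real values
at all real points near `0`. -/
lemma AnalyticAt.eventually_im_eq_zero {e : ℂ → ℂ} (he : AnalyticAt ℂ e 0)
    (h : ∃ᶠ t : ℝ in 𝓝[≠] 0, (e t).im = 0) : ∀ᶠ t : ℝ in 𝓝 0, (e t).im = 0 := by
  have he' : AnalyticAt ℝ e (Complex.ofRealCLM 0) := by
    simpa using he.restrictScalars (𝕜 := ℝ)
  have : AnalyticAt ℝ (fun t : ℝ ↦ Complex.imCLM (e (Complex.ofRealCLM t))) 0 :=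
    (Complex.imCLM.analyticAt _).comp (he'.comp (Complex.ofRealCLM.analyticAt 0))
  exact this.frequently_zero_iff_eventually_zero.1 h

lemma not_eventually_eq_zero_of_injOn {f : ℂ → ℂ} (hf0 : f 0 = 0) {N : Set ℝ} (hN : N ∈ 𝓝 0)
    (hinj : InjOn (fun t : ℝ ↦ f t) N) : ¬ ∀ᶠ z in 𝓝 0, f z = 0 := by
  intro h
  have h' : ∀ᶠ t : ℝ in 𝓝 0, f t = 0 :=
    (Complex.continuous_ofReal.tendsto' 0 0 Complex.ofReal_zero).eventually h
  obtain ⟨t, ht0, ht, htN⟩ := ((eventually_mem_nhdsWithin (a := (0 : ℝ)) (s := {0}ᶜ)).and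
    (nhdsWithin_le_nhds (h'.and hN))).exists
  exact ht0 (hinj htN (mem_of_mem_nhds hN) (by simpa [hf0] using ht))

/-- A nonzero analytic germ vanishing at `0` is a power of an invertible germ. -/
lemma AnalyticAt.exists_eventually_eq_pow {f : ℂ → ℂ} (hf : AnalyticAt ℂ f 0) (hf0 : f 0 = 0)
    (hne : ¬ ∀ᶠ z in 𝓝 0, f z = 0) :
    ∃ (n : ℕ) (χ : ℂ → ℂ), n ≠ 0 ∧ AnalyticAt ℂ χ 0 ∧ χ 0 = 0 ∧ deriv χ 0 ≠ 0 ∧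
      ∀ᶠ z in 𝓝 0, f z = χ z ^ n := by
  obtain ⟨n, h, hh, hh0, hfh⟩ := hf.exists_eventuallyEq_pow_smul_nonzero_iff.2 hne
  have hn : n ≠ 0 := by
    rintro rfl
    have := hfh.self_of_nhds
    simp [hf0] at this
    exact hh0 this.symm
  obtain ⟨r, hr, hr0, hrh⟩ := hh.exists_pow_eq hh0 hn
  refine ⟨n, fun z ↦ z * r z, hn, analyticAt_id.mul hr, zero_mul _, ?_, ?_⟩
  · have : HasDerivAt (fun z ↦ z * r z) (1 * r 0 + 0 * deriv r 0) 0 :=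
      (hasDerivAt_id (0 : ℂ)).mul hr.differentiableAt.hasDerivAt
    rw [this.deriv]
    simpa using hr0
  · filter_upwards [hfh] with z hz
    rw [hz, mul_pow, hrh, sub_zero, smul_eq_mul]

lemma AnalyticAt.exists_local_inverse {χ : ℂ → ℂ} (hχ : AnalyticAt ℂ χ 0) (hχ0 : χ 0 = 0)
    (hχ' : deriv χ 0 ≠ 0) :
    ∃ κ : ℂ → ℂ, AnalyticAt ℂ κ 0 ∧ κ 0 = 0 ∧ (∀ᶠ w in 𝓝 0, κ (χ w) = w) ∧
      ∀ᶠ v in 𝓝 0, χ (κ v) = v := by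
  have hl := hχ.hasStrictDerivAt.eventually_left_inverse hχ'
  have hr := hχ.hasStrictDerivAt.eventually_right_inverse hχ'
  have ha := hχ.analyticAt_localInverse hχ'
  rw [hχ0] at hr ha
  refine ⟨_, ha, ?_, hl, hr⟩
  simpa [hχ0] using hl.self_of_nhds

/-- Two analytic germs, injective on the reals, whose images of the reals share points
accumulating at `0`: up to an odd power reparametrization, one is a real reparametrization of the
other. -/
lemma exists_odd_pow_reparametrization {f g : ℂ → ℂ} (hf : AnalyticAt ℂ f 0)
    (hg : AnalyticAt ℂ g 0) (hf0 : f 0 = 0) (hg0 : g 0 = 0) {M N : Set ℝ}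
    (hM : M ∈ 𝓝 0) (hN : N ∈ 𝓝 0)
    (hfM : InjOn (fun t : ℝ ↦ f t) M) (hgN : InjOn (fun t : ℝ ↦ g t) N)
    (hfreq : ∃ᶠ p : ℝ × ℝ in 𝓝[≠] 0, f p.1 = g p.2) :
    ∃ (k : ℕ) (σ : ℝ) (E : ℝ → ℝ), Odd k ∧ σ ^ 2 = 1 ∧ E 0 = 0 ∧
      ∀ᶠ t : ℝ in 𝓝 0, ContinuousAt E t ∧ f (σ * t ^ k : ℝ) = g (E t) := by
  have hne_f := not_eventually_eq_zero_of_injOn hf0 hM hfM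
  have hne_g := not_eventually_eq_zero_of_injOn hg0 hN hgN
  obtain ⟨n, χ, hn, hχ, hχ0, hχ', hgχ⟩ := hg.exists_eventually_eq_pow hg0 hne_g
  obtain ⟨m, h, hh, hh0, hfh⟩ := hf.exists_eventuallyEq_pow_smul_nonzero_iff.2 hne_f
  have hm : m ≠ 0 := by
    rintro rfl
    have := hfh.self_of_nhds
    simp [hf0] at this
    exact hh0 this.symm
  obtain ⟨κ, hκ, hκ0, hκχ, hχκ⟩ := hχ.exists_local_inverse hχ0 hχ'
  obtain ⟨k, l, hkl, hkm⟩ : ∃ k l : ℕ, Nat.Coprime k l ∧ k * m = l * n := by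
    have hd : 0 < n.gcd m := Nat.gcd_pos_of_pos_left _ (Nat.pos_of_ne_zero hn)
    refine ⟨n / n.gcd m, m / n.gcd m, Nat.coprime_div_gcd_div_gcd hd, ?_⟩
    rw [Nat.div_mul_right_comm (Nat.gcd_dvd_left n m),
      Nat.div_mul_right_comm (Nat.gcd_dvd_right n m), mul_comm]
  have hk : k ≠ 0 := by
    rintro rfl
    have := hkm.symm
    simp only [zero_mul, mul_eq_zero, hn, or_false] at this
    simp [this] at hkl
  have hl : l ≠ 0 := by
    rintro rfl
    simp [hk, hm] at hkm
  -- nonzero coordinates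
  have hfreq1 : ∃ᶠ p : ℝ × ℝ in 𝓝[≠] 0, p.1 ≠ 0 ∧ f p.1 = g p.2 := by
    refine (hfreq.and_eventually (eventually_mem_nhdsWithin.and (nhdsWithin_le_nhds
      ((continuous_snd.tendsto (0 : ℝ × ℝ)).eventually hN)))).mono ?_
    rintro ⟨x, y⟩ ⟨hxy, hne, hy⟩
    refine ⟨?_, hxy⟩
    rintro rfl
    refine hne ?_
    have : y = 0 := hgN hy (mem_of_mem_nhds hN) (by simpa [hf0, hg0] using hxy.symm)
    simp [this]
  obtain ⟨σ, hσ, hfreq2⟩ : ∃ σ : ℝ, σ ^ 2 = 1 ∧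
      ∃ᶠ p : ℝ × ℝ in 𝓝[≠] 0, 0 < σ * p.1 ∧ f p.1 = g p.2 := by
    have : ∃ᶠ p : ℝ × ℝ in 𝓝[≠] 0, (0 < 1 * p.1 ∧ f p.1 = g p.2) ∨
        (0 < -1 * p.1 ∧ f p.1 = g p.2) := by
      refine hfreq1.mono fun p hp ↦ ?_
      rcases hp.1.lt_or_gt with h | h
      · exact Or.inr ⟨by linarith, hp.2⟩
      · exact Or.inl ⟨by linarith, hp.2⟩
    rcases frequently_or_distrib.1 this with h | h
    · exact ⟨1, by norm_num, h⟩
    · exact ⟨-1, by norm_num, h⟩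
  have hσ0 : σ ≠ 0 := by
    rintro rfl
    norm_num at hσ
  have hσk : AnalyticAt ℂ (fun z : ℂ ↦ (σ : ℂ) * z ^ k) 0 := by fun_prop
  have hσk0 : (σ : ℂ) * 0 ^ k = 0 := by simp [hk]
  obtain ⟨r, hr, hr0, hrh⟩ := AnalyticAt.exists_pow_eq (n := n)
    (h := fun z ↦ (σ : ℂ) ^ m * h (σ * z ^ k)) (z₀ := 0)
    (analyticAt_const.mul (hh.comp_of_eq hσk hσk0))
    (by simp only [hσk0]; exact mul_ne_zero (pow_ne_zero _ (by exact_mod_cast hσ0)) hh0) hn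
  have hfr : ∀ᶠ z : ℂ in 𝓝 0, f (σ * z ^ k) = (z ^ l * r z) ^ n := by
    have ht : Tendsto (fun z : ℂ ↦ (σ : ℂ) * z ^ k) (𝓝 0) (𝓝 0) := by
      simpa [hk] using hσk.continuousAt.tendsto
    filter_upwards [ht.eventually hfh] with z hz
    rw [hz, mul_pow (z ^ l), hrh, sub_zero, smul_eq_mul, mul_pow, ← pow_mul, ← pow_mul, hkm]
    ring
  -- the positive parameter of a point
  let τ : ℝ × ℝ → ℝ := fun p ↦ (σ * p.1) ^ ((k : ℝ)⁻¹)
  have hτ0 : Tendsto τ (𝓝[≠] 0) (𝓝 0) := by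
    have : Continuous τ := (continuous_const.mul continuous_fst).rpow_const fun _ ↦
      Or.inr (by positivity)
    have h0 : τ 0 = 0 := by
      have : (k : ℝ)⁻¹ ≠ 0 := by positivity
      simp [τ, Real.zero_rpow this]
    exact (this.tendsto' 0 0 h0).mono_left nhdsWithin_le_nhds
  have hτC : Tendsto (fun p ↦ (τ p : ℂ)) (𝓝[≠] 0) (𝓝 0) :=
    (Complex.continuous_ofReal.tendsto' 0 0 Complex.ofReal_zero).comp hτ0
  have hτk : ∀ p : ℝ × ℝ, 0 < σ * p.1 → 0 < τ p ∧ (σ : ℂ) * (τ p : ℂ) ^ k = p.1 := by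
    intro p hp
    refine ⟨Real.rpow_pos_of_pos hp _, ?_⟩
    have : τ p ^ k = σ * p.1 := Real.rpow_inv_natCast_pow hp.le hk
    rw [← Complex.ofReal_pow, this, ← Complex.ofReal_mul, ← mul_assoc, ← sq, hσ, one_mul]
  have hsnd : Tendsto (fun p : ℝ × ℝ ↦ (p.2 : ℂ)) (𝓝[≠] 0) (𝓝 0) :=
    ((Complex.continuous_ofReal.comp continuous_snd).tendsto' 0 0 (by simp)).mono_left
      nhdsWithin_le_nhds
  have hrne : ∀ᶠ z in 𝓝 (0 : ℂ), r z ≠ 0 := hr.continuousAt.eventually_ne hr0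
  -- the root of unity relating both parametrizations
  have hfreq3 : ∃ᶠ p : ℝ × ℝ in 𝓝[≠] 0, ∃ ζ ∈ (Polynomial.nthRootsFinset n (1 : ℂ)),
      0 < τ p ∧ (p.2 : ℂ) = κ (ζ * ((τ p : ℂ) ^ l * r (τ p))) := by
    refine (hfreq2.and_eventually (((hτC.eventually hfr).and (hτC.eventually hrne)).and
      ((hsnd.eventually hgχ).and (hsnd.eventually hκχ)))).mono ?_
    rintro p ⟨⟨hp, hfg⟩, ⟨hp1, hp2⟩, hp3, hp4⟩
    obtain ⟨hτp, hτp'⟩ := hτk p hp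
    rw [hτp', hfg, hp3] at hp1
    have hne : (τ p : ℂ) ^ l * r (τ p) ≠ 0 :=
      mul_ne_zero (pow_ne_zero _ (by exact_mod_cast hτp.ne')) hp2
    refine ⟨χ p.2 / ((τ p : ℂ) ^ l * r (τ p)), ?_, hτp, ?_⟩
    · rw [Polynomial.mem_nthRootsFinset (Nat.pos_of_ne_zero hn), div_pow, hp1,
        div_self (pow_ne_zero _ hne)]
    · rw [div_mul_cancel₀ _ hne, hp4]
  obtain ⟨ζ, hζ, hfreq4⟩ := (Finset.frequently_exists _).1 hfreq3
  rw [Polynomial.mem_nthRootsFinset (Nat.pos_of_ne_zero hn)] at hζ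
  have hζ0 : ζ ≠ 0 := by
    rintro rfl
    simp [hn] at hζ
  let q : ℂ → ℂ := fun z ↦ ζ * (z ^ l * r z)
  have hq : AnalyticAt ℂ q 0 := by fun_prop
  have hq0 : q 0 = 0 := by simp [q, hl]
  let e : ℂ → ℂ := fun z ↦ κ (q z)
  have he : AnalyticAt ℂ e 0 := hκ.comp_of_eq hq hq0
  have he0 : e 0 = 0 := by simp [e, hq0, hκ0]
  have hreal : ∀ᶠ t : ℝ in 𝓝 0, (e t).im = 0 := by
    refine he.eventually_im_eq_zero ?_
    have hτ : Tendsto τ (𝓝[≠] 0 ⊓ 𝓟 {p | 0 < τ p}) (𝓝[≠] 0) := by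
      refine tendsto_nhdsWithin_iff.2 ⟨hτ0.mono_left inf_le_left, ?_⟩
      refine eventually_inf_principal.2 (Eventually.of_forall fun p hp ↦ ?_)
      exact ne_of_gt hp
    refine hτ.frequently (frequently_inf_principal.2 (hfreq4.mono fun p hp ↦ ⟨hp.1, ?_⟩))
    change (κ (ζ * ((τ p : ℂ) ^ l * r (τ p)))).im = 0
    rw [← hp.2, Complex.ofReal_im]
  have hqt : Tendsto q (𝓝 0) (𝓝 0) := by simpa [hq0] using hq.continuousAt.tendsto
  have het : Tendsto e (𝓝 0) (𝓝 0) := by simpa [he0] using he.continuousAt.tendsto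
  have hχe : ∀ᶠ z in 𝓝 0, χ (e z) = q z := hqt.eventually hχκ
  have hfe : ∀ᶠ z in 𝓝 (0 : ℂ), f (σ * z ^ k) = g (e z) := by
    filter_upwards [hfr, het.eventually hgχ, hχe] with z h1 h2 h3
    rw [h1, h2, h3, mul_pow ζ, hζ, one_mul]
  let E : ℝ → ℝ := fun t ↦ (e t).re
  have hofReal : Tendsto ((↑) : ℝ → ℂ) (𝓝 0) (𝓝 0) :=
    Complex.continuous_ofReal.tendsto' 0 0 Complex.ofReal_zero
  have hE : ∀ᶠ t : ℝ in 𝓝 0, (E t : ℂ) = e t := by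
    filter_upwards [hreal] with t ht
    exact Complex.ext (by simp [E]) (by simp [ht])
  have hE0 : E 0 = 0 := by simp [E, he0]
  have hEc : ∀ᶠ t : ℝ in 𝓝 0, ContinuousAt E t := by
    filter_upwards [hofReal.eventually he.eventually_analyticAt] with t ht
    exact Complex.continuous_re.continuousAt.comp
      (ht.continuousAt.comp Complex.continuous_ofReal.continuousAt)
  have hfE : ∀ᶠ t : ℝ in 𝓝 0, f (σ * t ^ k : ℝ) = g (E t) := by
    filter_upwards [hE, hofReal.eventually hfe] with t h1 h2
    rw [h1, ← h2]
    push_cast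
    rfl
  refine ⟨k, σ, E, ?_, hσ, hE0, hEc.and hfE⟩
  -- an even power would contradict injectivity
  by_contra hodd
  rw [Nat.not_odd_iff_even] at hodd
  have hlodd : Odd l := by
    rw [← Nat.not_even_iff_odd]
    intro hle
    have := Nat.dvd_gcd hodd.two_dvd hle.two_dvd
    rw [hkl] at this
    norm_num at this
  have hneg : Tendsto (fun t : ℝ ↦ -t) (𝓝 0) (𝓝 0) := continuous_neg.tendsto' 0 0 neg_zero
  have hEt : Tendsto E (𝓝 0) (𝓝 0) := by simpa [hE0] using hEc.self_of_nhds.tendsto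
  have heven : ∀ᶠ t : ℝ in 𝓝 0, E t = E (-t) := by
    filter_upwards [hfE, hneg.eventually hfE, hEt.eventually hN,
      (hEt.comp hneg).eventually hN] with t h1 h2 h3 h4
    refine hgN h3 h4 ?_
    change g (E t) = g (E (-t))
    rw [← h1, ← h2, hodd.neg_pow]
  have hrneg : ∀ᶠ t : ℝ in 𝓝[≠] 0, r t = - r (-t) := by
    filter_upwards [eventually_mem_nhdsWithin, nhdsWithin_le_nhds heven, nhdsWithin_le_nhds hE,
      nhdsWithin_le_nhds (hneg.eventually hE), nhdsWithin_le_nhds (hofReal.eventually hχe),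
      nhdsWithin_le_nhds ((hofReal.comp hneg).eventually hχe)] with t h0 h1 h2 h3 h4 h5
    have h0' : (t : ℂ) ^ l ≠ 0 := pow_ne_zero _ (by exact_mod_cast h0)
    have h6 : q t = q (-t) := by
      rw [← h4, ← h2, h1, h3]
      simpa using h5
    simp only [q, hlodd.neg_pow] at h6
    refine mul_left_cancel₀ h0' ((mul_left_cancel₀ hζ0 h6).trans ?_)
    ring
  have hrt : Tendsto (fun t : ℝ ↦ r t) (𝓝[≠] 0) (𝓝 (r 0)) :=
    (hr.continuousAt.tendsto.comp hofReal).mono_left nhdsWithin_le_nhds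
  have hrt' : Tendsto (fun t : ℝ ↦ - r (-t)) (𝓝[≠] 0) (𝓝 (- r 0)) := by
    have : Tendsto (fun t : ℝ ↦ -(t : ℂ)) (𝓝 0) (𝓝 0) := by
      simpa using hofReal.neg
    exact ((hr.continuousAt.tendsto.comp this).neg).mono_left nhdsWithin_le_nhds
  have := tendsto_nhds_unique (hrt.congr' hrneg) hrt'
  exact hr0 (self_eq_neg.1 this)

/-- If two analytic germs, injective on the reals, identify real points accumulating at `(0, 0)`,
then they identify the graph of a continuous function near `(0, 0)`. -/
lemma exists_continuous_branch {f g : ℂ → ℂ} (hf : AnalyticAt ℂ f 0)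
    (hg : AnalyticAt ℂ g 0) (hf0 : f 0 = 0) (hg0 : g 0 = 0) {M N : Set ℝ}
    (hM : M ∈ 𝓝 0) (hN : N ∈ 𝓝 0)
    (hfM : InjOn (fun t : ℝ ↦ f t) M) (hgN : InjOn (fun t : ℝ ↦ g t) N)
    (hfreq : ∃ᶠ p : ℝ × ℝ in 𝓝[≠] 0, f p.1 = g p.2) :
    ∃ φ : ℝ → ℝ, φ 0 = 0 ∧ ∀ᶠ t : ℝ in 𝓝 0, ContinuousAt φ t ∧ f t = g (φ t) := by
  obtain ⟨k, σ, E, hk, hσ, hE0, hE⟩ :=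
    exists_odd_pow_reparametrization hf hg hf0 hg0 hM hN hfM hgN hfreq
  have hk0 : k ≠ 0 := hk.pos.ne'
  have hbot : Tendsto (fun t : ℝ ↦ t ^ k) atBot atBot := by
    simpa [hk.neg_pow, Function.comp_def] using tendsto_neg_atTop_atBot.comp
      ((tendsto_pow_atTop (α := ℝ) hk0).comp tendsto_neg_atBot_atTop)
  have hsurj : Function.Surjective fun t : ℝ ↦ t ^ k :=
    (continuous_pow k).surjective (tendsto_pow_atTop hk0) hbot
  let R : ℝ ≃ₜ ℝ := (hk.strictMono_pow.orderIsoOfSurjective _ hsurj).toHomeomorph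
  have hR (t : ℝ) : R.symm t ^ k = t := R.apply_symm_apply t
  let ρ : ℝ → ℝ := fun t ↦ R.symm (σ * t)
  have hρ : Continuous ρ := R.symm.continuous.comp (continuous_const.mul continuous_id)
  have hρk (t : ℝ) : σ * ρ t ^ k = t := by
    rw [hR, ← mul_assoc, ← sq, hσ, one_mul]
  have hρ0 : ρ 0 = 0 := by
    have := hR (σ * 0)
    rw [mul_zero] at this
    simpa [ρ] using pow_eq_zero_iff hk0 |>.1 this
  refine ⟨fun t ↦ E (ρ t), by simp [hρ0, hE0], ?_⟩
  filter_upwards [(hρ.tendsto' 0 0 hρ0).eventually hE] with t ht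
  refine ⟨ContinuousAt.comp ht.1 hρ.continuousAt, ?_⟩
  rw [← ht.2, hρk]

/-- The pairs of distinct points identified by `f`. -/
def selfIntersections {α X : Type*} (f : α → X) : Set (α × α) :=
  {p | p.1 ≠ p.2 ∧ f p.1 = f p.2}

lemma isClosed_selfIntersections {α X : Type*} [TopologicalSpace α] [T2Space α]
    [TopologicalSpace X] [T2Space X] {f : α → X} (hf : Continuous f)
    (hinj : ∀ a, ∃ N ∈ 𝓝 a, InjOn f N) : IsClosed (selfIntersections f) := by
  rw [← isOpen_compl_iff, isOpen_iff_eventually]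
  rintro ⟨a, b⟩ hab
  by_cases h : a = b
  · subst h
    obtain ⟨N, hN, hNinj⟩ := hinj a
    filter_upwards [prod_mem_nhds hN hN] with p hp hpS
    exact hpS.1 (hNinj hp.1 hp.2 hpS.2)
  · have hne : f a ≠ f b := fun h' ↦ hab ⟨h, h'⟩
    have : ∀ᶠ p : α × α in 𝓝 (a, b), f p.1 ≠ f p.2 :=
      (isOpen_ne_fun (hf.comp continuous_fst) (hf.comp continuous_snd)).mem_nhds hne
    filter_upwards [this] with p hp hpS using hp hpS.2

lemma swap_mem_derivedSet_selfIntersections {α X : Type*} [TopologicalSpace α] {f : α → X}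
    {p : α × α} (hp : p ∈ derivedSet (selfIntersections f)) :
    p.swap ∈ derivedSet (selfIntersections f) := by
  refine (AccPt.map hp continuous_swap.continuousAt Prod.swap_injective).mono ?_
  rw [map_principal, principal_mono]
  rintro _ ⟨q, hq, rfl⟩
  exact ⟨hq.1.symm, hq.2.symm⟩

/-- If the accumulation points of the self-intersections of a locally injective curve lie on
graphs of self-intersections, they form a monotone curve. -/
lemma isMonotoneCurve_derivedSet {X : Type*} [TopologicalSpace X] [T2Space X] {f : ℝ → X}
    (hf : Continuous f) (hinj : ∀ a, ∃ N ∈ 𝓝 a, InjOn f N)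
    (hbranch : ∀ p ∈ derivedSet (selfIntersections f), ∃ φ : ℝ → ℝ, φ p.1 = p.2 ∧
      ∀ᶠ t in 𝓝 p.1, ContinuousAt φ t ∧ f t = f (φ t)) :
    IsMonotoneCurve (derivedSet (selfIntersections f)) := by
  have hS := isClosed_selfIntersections hf hinj
  have hDS := (isClosed_iff_derivedSet_subset _).1 hS
  have hgraph : ∀ p ∈ derivedSet (selfIntersections f), ∃ φ : ℝ → ℝ, φ p.1 = p.2 ∧
      ContinuousAt φ p.1 ∧ ∀ᶠ t in 𝓝 p.1, (t, φ t) ∈ derivedSet (selfIntersections f) := by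
    intro p hp
    obtain ⟨φ, hφp, hφ⟩ := hbranch p hp
    have hlim : Tendsto (fun t ↦ (t, φ t)) (𝓝 p.1) (𝓝 p) := by
      have := (continuousAt_id.prodMk hφ.self_of_nhds.1).tendsto
      rwa [id, hφp] at this
    have hne : ∀ᶠ t in 𝓝 p.1, t ≠ φ t :=
      hlim.eventually ((isOpen_ne_fun continuous_fst continuous_snd).mem_nhds (hDS hp).1)
    refine ⟨φ, hφp, hφ.self_of_nhds.1, ?_⟩
    filter_upwards [(hφ.and hne).eventually_nhds] with t ht
    rw [mem_derivedSet, accPt_iff_frequently_nhdsNE]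
    have hlim : Tendsto (fun u ↦ (u, φ u)) (𝓝[≠] t) (𝓝[≠] (t, φ t)) := by
      refine tendsto_nhdsWithin_iff.2 ⟨?_, ?_⟩
      · exact (continuousAt_id.prodMk ht.self_of_nhds.1.1).tendsto.mono_left nhdsWithin_le_nhds
      · filter_upwards [eventually_mem_nhdsWithin] with u hu h
        exact hu (congrArg Prod.fst h)
    refine hlim.frequently (Eventually.frequently ?_)
    filter_upwards [nhdsWithin_le_nhds ht] with u hu using ⟨hu.2, hu.1.2⟩
  refine ⟨isClosed_derivedSet _, fun p hp ↦ (hDS hp).1, fun p hp ↦ ?_, fun p hp ↦ ?_,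
    fun p hp ↦ ?_⟩
  · obtain ⟨φ, hφp, hφ⟩ := hbranch p hp
    obtain ⟨M, hM, hfM⟩ := hinj p.1
    obtain ⟨N, hN, hfN⟩ := hinj p.2
    have hφN : ∀ᶠ t in 𝓝 p.1, φ t ∈ N :=
      hφ.self_of_nhds.1.eventually (by rw [hφp]; exact hN)
    obtain ⟨δ, hδ, hball⟩ := Metric.eventually_nhds_iff_ball.1 (hφ.and (hφN.and hM))
    rw [Real.ball_eq_Ioo] at hball
    have hmono := ContinuousOn.strictMonoOn_of_injOn_Ioo (f := φ) (a := p.1 - δ) (b := p.1 + δ)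
      (by linarith) (fun t ht ↦ (hball t ht).1.1.continuousWithinAt) (by
        intro t ht u hu htu
        refine hfM (hball t ht).2.2 (hball u hu).2.2 ?_
        rw [(hball t ht).1.2, (hball u hu).1.2, htu])
    have hV : Ioo (p.1 - δ) (p.1 + δ) ×ˢ N ∈ 𝓝 p :=
      prod_mem_nhds (Ioo_mem_nhds (by linarith) (by linarith)) hN
    have hsnd : ∀ q ∈ Ioo (p.1 - δ) (p.1 + δ) ×ˢ N, q ∈ derivedSet (selfIntersections f) →
        q.2 = φ q.1 := fun q hq hqD ↦
      hfN hq.2 (hball _ hq.1).2.1 ((hDS hqD).2.symm.trans (hball _ hq.1).1.2)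
    refine hmono.imp (fun h ↦ ⟨_, hV, fun q hq r hr hqD hrD hqr ↦ ?_⟩)
      (fun h ↦ ⟨_, hV, fun q hq r hr hqD hrD hqr ↦ ?_⟩)
    all_goals
      rw [hsnd q hq hqD, hsnd r hr hrD]
      exact h hq.1 hr.1 hqr
  all_goals
    obtain ⟨φ, hφp, hφc, hφ⟩ := hgraph p hp
    have hlim : Tendsto (fun t ↦ (t, φ t)) (𝓝 p.1) (𝓝 p) := by
      have := (continuousAt_id.prodMk hφc).tendsto
      rwa [id, hφp] at this
  · have hlim' : Tendsto (fun t ↦ (t, φ t)) (𝓝[>] p.1) (𝓝[derivedSet (selfIntersections f)] p) :=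
      tendsto_nhdsWithin_iff.2 ⟨hlim.mono_left nhdsWithin_le_nhds, nhdsWithin_le_nhds hφ⟩
    exact hlim'.frequently (Eventually.frequently eventually_mem_nhdsWithin)
  · have hlim' : Tendsto (fun t ↦ (t, φ t)) (𝓝[<] p.1) (𝓝[derivedSet (selfIntersections f)] p) :=
      tendsto_nhdsWithin_iff.2 ⟨hlim.mono_left nhdsWithin_le_nhds, nhdsWithin_le_nhds hφ⟩
    exact hlim'.frequently (Eventually.frequently eventually_mem_nhdsWithin)

/-- Accumulation points of the self-intersections of an analytic, locally injective curve lie on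
graphs of self-intersections. -/
lemma exists_branch_of_mem_derivedSet {F : ℂ → ℂ} (hF : ∀ x : ℝ, AnalyticAt ℂ F x)
    (hinj : ∀ a : ℝ, ∃ N ∈ 𝓝 a, InjOn (fun t : ℝ ↦ F t) N) {p : ℝ × ℝ}
    (hp : p ∈ derivedSet (selfIntersections fun t : ℝ ↦ F t)) (hFp : F p.1 = F p.2) :
    ∃ φ : ℝ → ℝ, φ p.1 = p.2 ∧ ∀ᶠ t in 𝓝 p.1, ContinuousAt φ t ∧ F t = F (φ t) := by
  have hshift (a : ℝ) : AnalyticAt ℂ (fun z ↦ F (a + z) - F a) 0 :=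
    ((hF a).comp_of_eq (analyticAt_const.add analyticAt_id) (by simp)).sub analyticAt_const
  have hloc (a : ℝ) : ∃ N ∈ 𝓝 (0 : ℝ), InjOn (fun t : ℝ ↦ F (a + t) - F a) N := by
    obtain ⟨N, hN, h⟩ := hinj a
    refine ⟨(a + ·) ⁻¹' N, (continuous_const_add a).tendsto' 0 a (add_zero a) hN,
      fun t ht u hu htu ↦ ?_⟩
    have := h ht hu (by simpa using htu)
    simpa using this
  obtain ⟨M, hM, hfM⟩ := hloc p.1
  obtain ⟨N, hN, hfN⟩ := hloc p.2
  obtain ⟨φ, hφ0, hφ⟩ := exists_continuous_branch (hshift p.1) (hshift p.2) (by simp) (by simp)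
    hM hN hfM hfN (by
      rw [mem_derivedSet, accPt_iff_frequently_nhdsNE] at hp
      have hlim : Tendsto (fun q : ℝ × ℝ ↦ q - p) (𝓝[≠] p) (𝓝[≠] 0) := by
        refine tendsto_nhdsWithin_iff.2 ⟨?_, ?_⟩
        · exact ((continuous_sub_right p).tendsto' p 0 (sub_self p)).mono_left nhdsWithin_le_nhds
        · filter_upwards [eventually_mem_nhdsWithin] with q hq
          exact sub_ne_zero.2 hq
      refine hlim.frequently (hp.mono fun q hq ↦ ?_)
      simpa [hFp] using hq.2)
  refine ⟨fun t ↦ p.2 + φ (t - p.1), by simp [hφ0], ?_⟩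
  filter_upwards [((continuous_sub_right p.1).tendsto' p.1 0 (sub_self p.1)).eventually hφ]
    with t ht
  refine ⟨continuousAt_const.add
    (ContinuousAt.comp (f := (· - p.1)) ht.1 (continuous_sub_right p.1).continuousAt), ?_⟩
  simpa [hFp] using ht.2

theorem loop_of_uncountable_self_intersections
    (F : ℂ → ℂ) (U : Set ℂ) (hU : IsOpen U) (hRU : ∀ x : ℝ, (x : ℂ) ∈ U)
    (hF : AnalyticOnNhd ℂ F U)
    (hinj : ∀ a : ℝ, ∃ ε > (0:ℝ),
      Set.InjOn (fun t : ℝ => F t) (Ioo (a - ε) (a + ε)))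
    (huncount : ¬ Set.Countable {p : ℝ × ℝ | p.1 ≠ p.2 ∧ F p.1 = F p.2}) :
    ∃ (γ δ : ℝ) (L : ℝ → ℂ), γ ≤ δ ∧ ContinuousOn L (Icc γ δ) ∧ L γ = L δ ∧
      range (fun t : ℝ => F t) = L '' Icc γ δ := by
  have hFan (x : ℝ) : AnalyticAt ℂ F x := hF x (hRU x)
  have hcont : Continuous fun t : ℝ ↦ F t := continuous_iff_continuousAt.2 fun t ↦
    (hFan t).continuousAt.comp Complex.continuous_ofReal.continuousAt
  have hinj' (a : ℝ) : ∃ N ∈ 𝓝 a, InjOn (fun t : ℝ ↦ F t) N := by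
    obtain ⟨ε, hε, h⟩ := hinj a
    exact ⟨_, Ioo_mem_nhds (by linarith) (by linarith), h⟩
  have hDS := (isClosed_iff_derivedSet_subset _).1 (isClosed_selfIntersections hcont hinj')
  have hD := isMonotoneCurve_derivedSet hcont hinj' fun p hp ↦
    exists_branch_of_mem_derivedSet hFan hinj' hp (hDS hp).2
  obtain ⟨p, hp⟩ : ∃ p, p ∈ derivedSet (selfIntersections fun t : ℝ ↦ F t) := by
    by_contra! h
    have := discreteTopology_of_noAccPts fun x _ ↦ h x
    exact huncount (countable_coe_iff.1 (countable_of_Lindelof_of_discrete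
      (X := selfIntersections fun t : ℝ ↦ F t)))
  wlog hlt : p.2 < p.1 generalizing p
  · exact this p.swap (swap_mem_derivedSet_selfIntersections hp)
      (lt_of_le_of_ne (not_lt.1 hlt) (hDS hp).1)
  exact ⟨p.2, p.1, fun t ↦ F t, hlt.le, hcont.continuousOn, (hDS hp).2.symm,
    hD.range_eq_image_Icc hcont (fun q hq ↦ (hDS hq).2) hp
      (swap_mem_derivedSet_selfIntersections hp) hlt⟩
end

section
/- If F is analytic in a complex neighborhood of ℝ, locally injective on ℝ, and unbounded on ℝ, then the set {(a,b) ∈ ℝ² : a ≠ b and F(a) = F(b)} is countable. -/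
open Set
open Filter Topology

lemma AnalyticAt.exists_analyticAt_pow_eq {G : ℂ → ℂ} {z₀ : ℂ} (hG : AnalyticAt ℂ G z₀)
    (h0 : G z₀ ≠ 0) {N : ℕ} (hN : N ≠ 0) :
    ∃ R : ℂ → ℂ, AnalyticAt ℂ R z₀ ∧ R z₀ ≠ 0 ∧ ∀ z, R z ^ N = G z := by
  obtain ⟨c, hc⟩ := IsAlgClosed.exists_pow_nat_eq (G z₀) (Nat.pos_of_ne_zero hN)
  have key : ∀ z, (c * (G z / G z₀) ^ ((N : ℂ)⁻¹)) ^ N = G z := fun z => by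
    rw [mul_pow, Complex.cpow_nat_inv_pow _ hN, hc, mul_div_cancel₀ _ h0]
  refine ⟨fun z => c * (G z / G z₀) ^ ((N : ℂ)⁻¹), ?_, ?_, key⟩
  · refine analyticAt_const.mul ((hG.div analyticAt_const h0).cpow analyticAt_const ?_)
    simp [div_self h0]
  · intro h
    have := key z₀
    simp only [h, zero_pow hN] at this
    exact h0 this.symm

/-- A nonconstant germ vanishing to order `p` becomes an `N`-th power of a local coordinate after
the substitution `z ↦ z ^ m`, where `p * m = N`. -/
lemma exists_coordinate_pow {f G : ℂ → ℂ} {p m N : ℕ} (hG : AnalyticAt ℂ G 0) (hG0 : G 0 ≠ 0)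
    (hf : ∀ᶠ z in 𝓝 0, f z = z ^ p * G z) (hm : m ≠ 0) (hN : N ≠ 0) (hpm : p * m = N) :
    ∃ H : ℂ → ℂ, AnalyticAt ℂ H 0 ∧ H 0 = 0 ∧ deriv H 0 ≠ 0 ∧
      ∀ᶠ z in 𝓝 0, f (z ^ m) = H z ^ N := by
  have hpow : Tendsto (fun z : ℂ => z ^ m) (𝓝 0) (𝓝 0) := by
    have : Continuous fun z : ℂ => z ^ m := by fun_prop
    simpa [hm] using this.tendsto 0
  obtain ⟨R, hR, hR0, hRN⟩ := hG.exists_analyticAt_pow_eq hG0 hN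
  have hRm : AnalyticAt ℂ (fun z => R (z ^ m)) 0 := by
    refine AnalyticAt.fun_comp (f := fun z : ℂ => z ^ m) (g := R) ?_ (by fun_prop)
    simpa [hm] using hR
  refine ⟨fun z => z * R (z ^ m), analyticAt_id.mul hRm, by simp, ?_, ?_⟩
  · have h := (hasDerivAt_id (0 : ℂ)).mul hRm.differentiableAt.hasDerivAt
    have h' : HasDerivAt (fun z : ℂ => z * R (z ^ m)) (R 0) 0 := by
      convert! h using 1
      simp [hm]
    rw [h'.deriv]
    exact hR0
  · filter_upwards [hpow.eventually hf] with z hz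
    rw [hz, mul_pow, hRN, ← pow_mul, mul_comm m, hpm]

/-- Two local coordinates at `0` which agree at arbitrarily small pairs of positive reals are
related by a real change of parameter. -/
lemma exists_real_reparam {H L : ℂ → ℂ} (hH : AnalyticAt ℂ H 0) (hL : AnalyticAt ℂ L 0)
    (hH0 : H 0 = 0) (hL0 : L 0 = 0) (hH' : deriv H 0 ≠ 0) (hL' : deriv L 0 ≠ 0)
    (hHL : ∀ δ > (0 : ℝ), ∃ y ∈ Ioo 0 δ, ∃ v ∈ Ioo 0 δ, H (y : ℝ) = L (v : ℝ)) :
    ∃ h : ℝ → ℝ, AnalyticAt ℝ h 0 ∧ h 0 = 0 ∧ deriv h 0 ≠ 0 ∧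
      ∀ᶠ x : ℝ in 𝓝 0, H x = L (h x) := by
  set I := hL.hasStrictDerivAt.localInverse _ _ _ hL'
  have hIa : AnalyticAt ℂ I 0 := by
    have := hL.analyticAt_localInverse hL'
    rwa [hL0] at this
  have hleft : ∀ᶠ z in 𝓝 0, I (L z) = z := HasStrictFDerivAt.eventually_left_inverse _
  have hright : ∀ᶠ z in 𝓝 0, L (I z) = z := by
    have : ∀ᶠ z in 𝓝 (L 0), L (I z) = z := HasStrictFDerivAt.eventually_right_inverse _
    rwa [hL0] at this
  have hI0 : I 0 = 0 := by simpa [hL0] using hleft.self_of_nhds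
  set ψ : ℂ → ℂ := fun z => I (H z) with hψ
  have hψa : AnalyticAt ℂ ψ 0 := AnalyticAt.fun_comp (by rwa [hH0]) hH
  have hψ0 : ψ 0 = 0 := by simp [hψ, hH0, hI0]
  have hLψ : ∀ᶠ z in 𝓝 0, L (ψ z) = H z := by
    have : Tendsto H (𝓝 0) (𝓝 0) := by simpa [hH0] using hH.continuousAt.tendsto
    exact this.eventually hright
  have hψ' : deriv ψ 0 ≠ 0 := by
    intro h
    have h1 : HasDerivAt (fun z => L (ψ z)) (deriv L (ψ 0) * deriv ψ 0) 0 :=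
      HasDerivAt.comp 0 (by rw [hψ0]; exact hL.differentiableAt.hasDerivAt)
        hψa.differentiableAt.hasDerivAt
    have h2 := h1.congr_of_eventuallyEq (hLψ.mono fun z hz => hz.symm)
    exact hH' (by simpa [h] using h2.deriv)
  have hofReal : Tendsto (fun x : ℝ => (x : ℂ)) (𝓝 0) (𝓝 0) := by
    simpa using Complex.continuous_ofReal.tendsto 0
  have him : ∀ᶠ x : ℝ in 𝓝 0, (ψ x).im = 0 := by
    have ha : AnalyticAt ℝ (fun x : ℝ => (ψ x).im) 0 :=
      AnalyticAt.im_ofReal (by simpa using hψa)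
    rw [← ha.frequently_zero_iff_eventually_zero]
    obtain ⟨ε, hε, hεl⟩ := Metric.eventually_nhds_iff.1 (hofReal.eventually hleft)
    rw [frequently_nhdsWithin_iff, Metric.nhds_basis_ball.frequently_iff]
    intro δ hδ
    obtain ⟨y, hy, v, hv, hyv⟩ := hHL (min δ ε) (lt_min hδ hε)
    refine ⟨y, ?_, ?_, hy.1.ne'⟩
    · simpa [abs_of_pos hy.1] using hy.2.trans_le (min_le_left _ _)
    · simp only [hψ, hyv]
      rw [hεl (by simpa [abs_of_pos hv.1] using hv.2.trans_le (min_le_right _ _))]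
      simp
  have hψd : HasDerivAt ψ (deriv ψ 0) ((0 : ℝ) : ℂ) := by
    simpa using hψa.differentiableAt.hasDerivAt
  have hre := hψd.real_of_complex
  have him' : (deriv ψ 0).im = 0 := by
    have h1 : HasDerivAt (fun x : ℝ => (ψ x).im) (deriv ψ 0).im 0 :=
      (Complex.imCLM.hasFDerivAt.comp_hasDerivAt (0 : ℝ) hψd.comp_ofReal)
    have h2 : HasDerivAt (fun _ : ℝ => (0 : ℝ)) (deriv ψ 0).im 0 :=
      h1.congr_of_eventuallyEq (him.mono fun x hx => hx.symm)
    exact h2.unique (hasDerivAt_const _ _)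
  refine ⟨fun x => (ψ x).re, AnalyticAt.re_ofReal (by simpa using hψa), by simp [hψ0], ?_, ?_⟩
  · rw [hre.deriv]
    exact fun h => hψ' (Complex.ext h him')
  · filter_upwards [him, hofReal.eventually hLψ] with x hx hx'
    rw [← hx']
    congr 1
    exact Complex.ext (by simp) (by simp [hx])

lemma exists_pow_reparam {f g : ℂ → ℂ} (hf : AnalyticAt ℂ f 0) (hg : AnalyticAt ℂ g 0)
    (hf0 : f 0 = 0) (hg0 : g 0 = 0) (hfc : ¬ ∀ᶠ z in 𝓝 0, f z = 0)
    (hgc : ¬ ∀ᶠ z in 𝓝 0, g z = 0)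
    (hfg : ∀ δ > (0 : ℝ), ∃ s ∈ Ioo 0 δ, ∃ t ∈ Ioo 0 δ, f (s : ℝ) = g (t : ℝ)) :
    ∃ (m k : ℕ) (h : ℝ → ℝ), m.Coprime k ∧ m ≠ 0 ∧ k ≠ 0 ∧ AnalyticAt ℝ h 0 ∧ h 0 = 0 ∧
      deriv h 0 ≠ 0 ∧ ∀ᶠ x : ℝ in 𝓝 0, f ((x ^ m : ℝ) : ℂ) = g ((h x ^ k : ℝ) : ℂ) := by
  obtain ⟨p, A, hA, hA0, hfA⟩ := hf.exists_eventuallyEq_pow_smul_nonzero_iff.2 hfc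
  obtain ⟨q, B, hB, hB0, hgB⟩ := hg.exists_eventuallyEq_pow_smul_nonzero_iff.2 hgc
  simp only [sub_zero, smul_eq_mul] at hfA hgB
  have hp : p ≠ 0 := by
    rintro rfl
    exact hA0 (by simpa [hf0] using hfA.self_of_nhds.symm)
  have hq : q ≠ 0 := by
    rintro rfl
    exact hB0 (by simpa [hg0] using hgB.self_of_nhds.symm)
  obtain ⟨k, m, hkm, hpk, hqm⟩ := Nat.exists_coprime p q
  have hk : k ≠ 0 := by rintro rfl; simp at hpk; exact hp hpk
  have hm : m ≠ 0 := by rintro rfl; simp at hqm; exact hq hqm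
  set N := p * m with hN
  have hN0 : N ≠ 0 := mul_ne_zero hp hm
  have hqk : q * k = N := by rw [hN]; nth_rw 1 [hqm]; nth_rw 2 [hpk]; ring
  obtain ⟨H, hH, hH0, hH', hfH⟩ := exists_coordinate_pow hA hA0 hfA hm hN0 rfl
  obtain ⟨L, hL, hL0, hL', hgL⟩ := exists_coordinate_pow hB hB0 hgB hk hN0 hqk
  have hofReal : Tendsto (fun x : ℝ => (x : ℂ)) (𝓝 0) (𝓝 0) := by
    simpa using Complex.continuous_ofReal.tendsto 0
  obtain ⟨ε₁, hε₁, h₁⟩ := Metric.eventually_nhds_iff.1 (hofReal.eventually hfH)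
  obtain ⟨ε₂, hε₂, h₂⟩ := Metric.eventually_nhds_iff.1 (hofReal.eventually hgL)
  have key : ∀ δ > (0 : ℝ), ∃ y ∈ Ioo 0 δ, ∃ v ∈ Ioo 0 δ, ∃ ζ : ℂ, ζ ^ N = 1 ∧
      H (y : ℝ) = ζ * L (v : ℝ) := by
    intro δ hδ
    set η := min δ (min ε₁ ε₂)
    have hη : 0 < η := by positivity
    have hroot : ∀ {n : ℕ} {s : ℝ}, n ≠ 0 → s ∈ Ioo 0 (η ^ n) → ∃ y ∈ Ioo 0 η, y ^ n = s := by
      intro n s hn hs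
      refine ⟨s ^ ((n : ℝ)⁻¹), ⟨by have := hs.1; positivity, ?_⟩,
        Real.rpow_inv_natCast_pow hs.1.le hn⟩
      refine lt_of_pow_lt_pow_left₀ n hη.le ?_
      rw [Real.rpow_inv_natCast_pow hs.1.le hn]
      exact hs.2
    obtain ⟨s, hs, t, ht, hst⟩ := hfg (min (η ^ m) (η ^ k)) (by positivity)
    obtain ⟨y, hy, rfl⟩ := hroot hm ⟨hs.1, hs.2.trans_le (min_le_left _ _)⟩
    obtain ⟨v, hv, rfl⟩ := hroot hk ⟨ht.1, ht.2.trans_le (min_le_right _ _)⟩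
    have hyv : H y ^ N = L v ^ N := by
      rw [← h₁ (by simpa [abs_of_pos hy.1] using
          hy.2.trans_le ((min_le_right _ _).trans (min_le_left _ _))),
        ← h₂ (by simpa [abs_of_pos hv.1] using
          hv.2.trans_le ((min_le_right _ _).trans (min_le_right _ _)))]
      simpa using hst
    refine ⟨y, ⟨hy.1, hy.2.trans_le (min_le_left _ _)⟩, v,
      ⟨hv.1, hv.2.trans_le (min_le_left _ _)⟩, ?_⟩
    by_cases hLv : L v = 0
    · refine ⟨1, one_pow _, ?_⟩
      rw [hLv, zero_pow hN0] at hyv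
      rw [hLv, mul_zero, eq_zero_of_pow_eq_zero hyv]
    · exact ⟨H y / L v, by rw [div_pow, hyv, div_self (pow_ne_zero _ hLv)],
        (div_mul_cancel₀ _ hLv).symm⟩
  have hfin : {ζ : ℂ | ζ ^ N = 1}.Finite := by
    refine (Polynomial.nthRootsFinset N (1 : ℂ)).finite_toSet.subset fun ζ hζ => ?_
    simpa [Polynomial.mem_nthRootsFinset (Nat.pos_of_ne_zero hN0)] using hζ
  obtain ⟨ζ, hζ, hζHL⟩ : ∃ ζ : ℂ, ζ ^ N = 1 ∧
      ∀ δ > (0 : ℝ), ∃ y ∈ Ioo 0 δ, ∃ v ∈ Ioo 0 δ, H (y : ℝ) = ζ * L (v : ℝ) := by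
    by_contra! hcon
    have hev : ∀ ζ ∈ {ζ : ℂ | ζ ^ N = 1}, ∀ᶠ δ : ℝ in 𝓝[>] 0,
        ∀ y ∈ Ioo 0 δ, ∀ v ∈ Ioo 0 δ, H (y : ℝ) ≠ ζ * L (v : ℝ) := by
      intro ζ hζ
      obtain ⟨δ, hδ, hne⟩ := hcon ζ hζ
      filter_upwards [Ioo_mem_nhdsGT hδ] with δ' hδ' y hy v hv
      exact hne y ⟨hy.1, hy.2.trans hδ'.2⟩ v ⟨hv.1, hv.2.trans hδ'.2⟩
    obtain ⟨δ, hδ, hδ0⟩ := (((eventually_all_finite hfin).2 hev).and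
      self_mem_nhdsWithin).exists
    obtain ⟨y, hy, v, hv, ζ, hζ, hH⟩ := key δ hδ0
    exact hδ ζ hζ y hy v hv hH
  have hζ0 : ζ ≠ 0 := by
    rintro rfl
    simp [hN0] at hζ
  obtain ⟨h, hha, hh0, hh', hhe⟩ := exists_real_reparam hH (L := fun z => ζ * L z)
    (analyticAt_const.mul hL) hH0 (by simp [hL0]) hH'
    (by rw [deriv_const_mul _ hL.differentiableAt]; exact mul_ne_zero hζ0 hL') hζHL
  refine ⟨m, k, h, hkm.symm, hm, hk, hha, hh0, hh', ?_⟩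
  have hht : Tendsto h (𝓝 0) (𝓝 0) := by simpa [hh0] using hha.continuousAt.tendsto
  filter_upwards [hhe, hofReal.eventually hfH, (hofReal.comp hht).eventually hgL] with x h1 h2 h3
  simp only [Function.comp] at h3
  push_cast
  rw [h2, h3, h1, mul_pow, hζ, one_mul]

lemma AnalyticAt.exists_signed_strictMono {h : ℝ → ℝ} {a : ℝ} (hh : AnalyticAt ℝ h a)
    (hd : deriv h a ≠ 0) :
    ∃ σ : ℝ, (σ = 1 ∨ σ = -1) ∧ ∃ ε > 0, ContinuousOn h (Ioo (a - ε) (a + ε)) ∧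
      ∀ x ∈ Ioo (a - ε) (a + ε), ∀ y ∈ Ioo (a - ε) (a + ε), x < y → 0 < σ * (h y - h x) := by
  have main : ∀ h : ℝ → ℝ, AnalyticAt ℝ h a → 0 < deriv h a →
      ∃ ε > 0, ContinuousOn h (Ioo (a - ε) (a + ε)) ∧ StrictMonoOn h (Ioo (a - ε) (a + ε)) := by
    intro h hh hd
    obtain ⟨ε, hε, hb⟩ := Metric.eventually_nhds_iff_ball.1
      (hh.eventually_analyticAt.and (hh.deriv.continuousAt.eventually_const_lt hd))
    rw [Real.ball_eq_Ioo] at hb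
    have hc : ContinuousOn h (Ioo (a - ε) (a + ε)) := fun x hx =>
      (hb x hx).1.continuousAt.continuousWithinAt
    refine ⟨ε, hε, hc, strictMonoOn_of_deriv_pos (convex_Ioo _ _) hc fun x hx => ?_⟩
    exact (hb x (interior_subset hx)).2
  rcases hd.lt_or_gt with hd | hd
  · obtain ⟨ε, hε, hc, hm⟩ := main (fun x => -h x) hh.neg (by simpa using hd)
    refine ⟨-1, Or.inr rfl, ε, hε, hc.neg.congr fun x _ => (neg_neg _).symm, fun x hx y hy hxy => ?_⟩
    have := hm hx hy hxy
    simp only at this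
    linarith
  · obtain ⟨ε, hε, hc, hm⟩ := main h hh hd
    refine ⟨1, Or.inl rfl, ε, hε, hc, fun x hx y hy hxy => ?_⟩
    have := hm hx hy hxy
    linarith

lemma odd_of_pow_reparam {E : Type*} {f g : ℝ → E} {m k : ℕ} {h : ℝ → ℝ} (hmk : m.Coprime k)
    (hm : m ≠ 0) (hk : k ≠ 0)
    (hh : AnalyticAt ℝ h 0) (hh0 : h 0 = 0) (hd : deriv h 0 ≠ 0)
    (hf : ∃ ε > 0, InjOn f (Ioo (-ε) ε)) (hg : ∃ ε > 0, InjOn g (Ioo (-ε) ε))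
    (hfg : ∀ᶠ x in 𝓝 0, f (x ^ m) = g (h x ^ k)) : Odd m ∧ Odd k := by
  obtain ⟨εf, hεf, hf⟩ := hf
  obtain ⟨εg, hεg, hg⟩ := hg
  have ht : Tendsto h (𝓝 0) (𝓝 0) := by simpa [hh0] using hh.continuousAt.tendsto
  have hpow : ∀ n : ℕ, n ≠ 0 → Tendsto (fun x : ℝ => x ^ n) (𝓝 0) (𝓝 0) := fun n hn => by
    simpa [hn] using (continuous_pow n).tendsto (0 : ℝ)
  have hnhds : ∀ ε : ℝ, 0 < ε → Ioo (-ε) ε ∈ 𝓝 (0 : ℝ) := fun ε hε =>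
    Ioo_mem_nhds (by linarith) hε
  have hx_small : ∀ᶠ x : ℝ in 𝓝 0, x ^ m ∈ Ioo (-εf) εf := hpow m hm (hnhds εf hεf)
  have hh_small : ∀ᶠ x in 𝓝 0, h x ^ k ∈ Ioo (-εg) εg := (hpow k hk).comp ht (hnhds εg hεg)
  constructor
  · by_contra hodd
    rw [Nat.not_odd_iff_even] at hodd
    have hkodd : Odd k := by
      by_contra hk'
      rw [Nat.not_odd_iff_even] at hk'
      exact Nat.not_coprime_of_dvd_of_dvd one_lt_two hodd.two_dvd hk'.two_dvd hmk
    obtain ⟨σ, -, ε, hε, -, hmono⟩ := hh.exists_signed_strictMono hd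
    have hev : ∀ᶠ x in 𝓝 (0 : ℝ), (f (x ^ m) = g (h x ^ k) ∧ h x ^ k ∈ Ioo (-εg) εg) ∧
        x ∈ Ioo (0 - ε) (0 + ε) :=
      (hfg.and hh_small).and (Ioo_mem_nhds (by linarith) (by linarith))
    have hneg : Tendsto (fun x : ℝ => -x) (𝓝 0) (𝓝 0) := by
      simpa using continuous_neg.tendsto (0 : ℝ)
    obtain ⟨x, ⟨⟨⟨h1, h2⟩, h3⟩, ⟨h4, h5⟩, h6⟩, hx⟩ :=
      (((hev.and (hneg.eventually hev)).filter_mono nhdsWithin_le_nhds).and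
        (self_mem_nhdsWithin (s := Ioi (0 : ℝ)))).exists
    have hx : 0 < x := hx
    have h7 : h x ^ k = h (-x) ^ k := hg h2 h5 (by rw [← h1, ← h4, hodd.neg_pow])
    have h8 := hmono _ h6 _ h3 (by linarith)
    rw [hkodd.strictMono_pow.injective h7] at h8
    simp at h8
  · by_contra hodd
    rw [Nat.not_odd_iff_even] at hodd
    have hmodd : Odd m := by
      by_contra hm'
      rw [Nat.not_odd_iff_even] at hm'
      exact Nat.not_coprime_of_dvd_of_dvd one_lt_two hm'.two_dvd hodd.two_dvd hmk
    have himg : ∀ᶠ w in 𝓝 (0 : ℝ), ∃ x, (f (x ^ m) = g (h x ^ k) ∧ x ^ m ∈ Ioo (-εf) εf) ∧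
        h x = w := by
      have := hh.hasStrictDerivAt.map_nhds_eq hd
      rw [hh0] at this
      rw [← this]
      exact (hfg.and hx_small).mono fun x hx => ⟨x, hx, rfl⟩
    have hneg : Tendsto (fun x : ℝ => -x) (𝓝 0) (𝓝 0) := by
      simpa using continuous_neg.tendsto (0 : ℝ)
    obtain ⟨w, ⟨⟨x, ⟨h1, h2⟩, h3⟩, x', ⟨h4, h5⟩, h6⟩, hw⟩ :=
      (((himg.and (hneg.eventually himg)).filter_mono nhdsWithin_le_nhds).and
        (self_mem_nhdsWithin (s := Ioi (0 : ℝ)))).exists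
    have hw : 0 < w := hw
    have h7 : x ^ m = x' ^ m := hf h2 h5 (by rw [h1, h4, h3, h6, hodd.neg_pow])
    rw [hmodd.strictMono_pow.injective h7] at h3
    linarith

/-- Near `(a, b)` the equation `f x = g y` is solved by the graph of a continuous function which
is strictly increasing if `σ = 1` and strictly decreasing if `σ = -1`. -/
def LocalBranch {E : Type*} (f g : ℝ → E) (σ a b : ℝ) : Prop :=
  ∃ ε > 0, ∃ φ : ℝ → ℝ, ContinuousOn φ (Ioo (a - ε) (a + ε)) ∧ φ a = b ∧
    (∀ x ∈ Ioo (a - ε) (a + ε), ∀ y ∈ Ioo (a - ε) (a + ε), x < y → 0 < σ * (φ y - φ x)) ∧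
    ∀ x ∈ Ioo (a - ε) (a + ε), f x = g (φ x)

lemma localBranch_of_pow_reparam {E : Type*} {f g : ℝ → E} {m k : ℕ} {h : ℝ → ℝ}
    (hm : Odd m) (hk : Odd k) (hh : AnalyticAt ℝ h 0) (hh0 : h 0 = 0) (hd : deriv h 0 ≠ 0)
    (hfg : ∀ᶠ x in 𝓝 0, f (x ^ m) = g (h x ^ k)) :
    ∃ σ : ℝ, (σ = 1 ∨ σ = -1) ∧ LocalBranch f g σ 0 0 := by
  obtain ⟨σ, hσ, ε, hε, hc, hmono⟩ := hh.exists_signed_strictMono hd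
  have hsurj : Function.Surjective fun x : ℝ => x ^ m :=
    (continuous_pow m).surjective (tendsto_pow_atTop hm.pos.ne')
      ((tendsto_neg_atTop_atBot.comp ((tendsto_pow_atTop hm.pos.ne').comp
        tendsto_neg_atBot_atTop)).congr fun x => by simp [hm.neg_pow])
  set e := hm.strictMono_pow.orderIsoOfSurjective _ hsurj
  have heapp : ∀ x : ℝ, e.symm x ^ m = x := fun x => e.apply_symm_apply x
  have he0 : e.symm 0 = 0 := by
    have := heapp 0
    exact eq_zero_of_pow_eq_zero this
  have het : Tendsto e.symm (𝓝 0) (𝓝 0) := by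
    simpa [he0] using e.symm.continuous.tendsto 0
  have hI : ∀ᶠ x in 𝓝 (0 : ℝ), x ∈ Ioo (0 - ε) (0 + ε) ∧ f (x ^ m) = g (h x ^ k) :=
    Eventually.and (Ioo_mem_nhds (by linarith) (by linarith)) hfg
  obtain ⟨δ, hδ, hδI⟩ := Metric.eventually_nhds_iff_ball.1 (het.eventually hI)
  rw [Real.ball_eq_Ioo] at hδI
  refine ⟨σ, hσ, δ, hδ, fun x => h (e.symm x) ^ k, ?_, ?_, ?_, ?_⟩
  · exact (hc.comp e.symm.continuous.continuousOn fun x hx => (hδI x hx).1).pow k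
  · simp [he0, hh0, hk.pos.ne']
  · intro x hx y hy hxy
    have := hmono _ (hδI x hx).1 _ (hδI y hy).1 (e.symm.strictMono hxy)
    rcases hσ with rfl | rfl
    · have := hk.strictMono_pow (show h (e.symm x) < h (e.symm y) by linarith)
      simp only at this
      linarith
    · have := hk.strictMono_pow (show h (e.symm y) < h (e.symm x) by linarith)
      simp only at this
      linarith
  · intro x hx
    have := (hδI x hx).2
    rwa [heapp] at this

lemma exists_localBranch_zero {f g : ℂ → ℂ} (hf : AnalyticAt ℂ f 0) (hg : AnalyticAt ℂ g 0)
    (hf0 : f 0 = 0) (hg0 : g 0 = 0)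
    (hfi : ∃ ε > 0, InjOn (fun t : ℝ => f t) (Ioo (-ε) ε))
    (hgi : ∃ ε > 0, InjOn (fun t : ℝ => g t) (Ioo (-ε) ε))
    (hfg : ∀ δ > (0 : ℝ), ∃ s ∈ Ioo 0 δ, ∃ t ∈ Ioo 0 δ, f (s : ℝ) = g (t : ℝ)) :
    ∃ σ : ℝ, (σ = 1 ∨ σ = -1) ∧
      LocalBranch (fun t : ℝ => f t) (fun t : ℝ => g t) σ 0 0 := by
  have hnc : ∀ f : ℂ → ℂ, f 0 = 0 → (∃ ε > 0, InjOn (fun t : ℝ => f t) (Ioo (-ε) ε)) →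
      ¬ ∀ᶠ z in 𝓝 0, f z = 0 := by
    rintro f hf0 ⟨ε, hε, hi⟩ hz
    have hofReal : Tendsto (fun x : ℝ => (x : ℂ)) (𝓝 0) (𝓝 0) := by
      simpa using Complex.continuous_ofReal.tendsto 0
    obtain ⟨x, ⟨hx, hxε⟩, hx0⟩ := ((((hofReal.eventually hz).filter_mono
      nhdsWithin_le_nhds).and (Ioo_mem_nhdsGT hε)).and
      (self_mem_nhdsWithin (s := Ioi (0 : ℝ)))).exists
    have := hi ⟨by linarith [hxε.1], hxε.2⟩ ⟨by linarith, hε⟩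
      (show f (x : ℝ) = f ((0 : ℝ) : ℂ) by simpa [hf0] using hx)
    exact hxε.1.ne' this
  obtain ⟨m, k, h, hmk, hm, hk, hh, hh0, hd, he⟩ :=
    exists_pow_reparam hf hg hf0 hg0 (hnc f hf0 hfi) (hnc g hg0 hgi) hfg
  obtain ⟨hmo, hko⟩ := odd_of_pow_reparam (f := fun t : ℝ => f t) (g := fun t : ℝ => g t)
    hmk hm hk hh hh0 hd hfi hgi he
  exact localBranch_of_pow_reparam hmo hko hh hh0 hd he

lemma LocalBranch.of_affine {E : Type*} {f g : ℝ → E} {σ α β a b : ℝ}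
    (hα : α = 1 ∨ α = -1) (hβ : β = 1 ∨ β = -1)
    (h : LocalBranch (fun t => f (a + α * t)) (fun t => g (b + β * t)) σ 0 0) :
    LocalBranch f g (σ * α * β) a b := by
  obtain ⟨ε, hε, φ, hc, h0, hmono, heq⟩ := h
  have hmem : ∀ x ∈ Ioo (a - ε) (a + ε), α * (x - a) ∈ Ioo (0 - ε) (0 + ε) := by
    intro x hx
    rcases hα with rfl | rfl <;> constructor <;> linarith [hx.1, hx.2]
  refine ⟨ε, hε, fun x => b + β * φ (α * (x - a)), ?_, by simp [h0], ?_, ?_⟩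
  · exact continuousOn_const.add (continuousOn_const.mul
      (hc.comp (Continuous.continuousOn (by fun_prop)) hmem))
  · intro x hx y hy hxy
    rcases hα with rfl | rfl
    · have := hmono _ (hmem x hx) _ (hmem y hy) (by linarith)
      rcases hβ with rfl | rfl <;> linarith
    · have := hmono _ (hmem y hy) _ (hmem x hx) (by linarith)
      rcases hβ with rfl | rfl <;> linarith
  · intro x hx
    have h := heq _ (hmem x hx)
    simp only [← mul_assoc, show α * α = 1 by rcases hα with rfl | rfl <;> norm_num] at h
    simpa using h

lemma exists_localBranch {F : ℂ → ℂ} {a b : ℝ} (hFa : AnalyticAt ℂ F a) (hFb : AnalyticAt ℂ F b)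
    (hia : ∃ ε > (0 : ℝ), InjOn (fun t : ℝ => F t) (Ioo (a - ε) (a + ε)))
    (hib : ∃ ε > (0 : ℝ), InjOn (fun t : ℝ => F t) (Ioo (b - ε) (b + ε)))
    (hab : F a = F b) (hfr : ∃ᶠ q in 𝓝[≠] ((a, b) : ℝ × ℝ), F q.1 = F q.2) :
    ∃ σ : ℝ, (σ = 1 ∨ σ = -1) ∧
      LocalBranch (fun t : ℝ => F t) (fun t : ℝ => F t) σ a b := by
  obtain ⟨εa, hεa, hia⟩ := hia
  obtain ⟨εb, hεb, hib⟩ := hib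
  have hnear : ∀ᶠ q in 𝓝 ((a, b) : ℝ × ℝ),
      q.1 ∈ Ioo (a - εa) (a + εa) ∧ q.2 ∈ Ioo (b - εb) (b + εb) :=
    (continuous_fst.continuousAt.eventually (Ioo_mem_nhds (by simpa) (by simpa))).and
      (continuous_snd.continuousAt.eventually (Ioo_mem_nhds (by simpa) (by simpa)))
  have hne : ∃ᶠ q in 𝓝 ((a, b) : ℝ × ℝ), (q.1 ≠ a ∧ q.2 ≠ b) ∧ F q.1 = F q.2 := by
    rw [frequently_nhdsWithin_iff] at hfr
    refine (hfr.and_eventually hnear).mono ?_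
    rintro ⟨s, t⟩ ⟨⟨hst, hq⟩, hs, ht⟩
    refine ⟨⟨?_, ?_⟩, hst⟩
    · rintro rfl
      exact hq (by rw [show t = b from hib ht ⟨by linarith, by linarith⟩ (hst.symm.trans hab)]; rfl)
    · rintro rfl
      exact hq (by rw [show s = a from hia hs ⟨by linarith, by linarith⟩ (hst.trans hab.symm)]; rfl)
  have hsign : ∃ α β : ℝ, (α = 1 ∨ α = -1) ∧ (β = 1 ∨ β = -1) ∧
      ∃ᶠ q in 𝓝 ((a, b) : ℝ × ℝ), 0 < α * (q.1 - a) ∧ 0 < β * (q.2 - b) ∧ F q.1 = F q.2 := by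
    by_contra! hcon
    have h : ∀ α β : ℝ, (α = 1 ∨ α = -1) → (β = 1 ∨ β = -1) →
        ∀ᶠ q in 𝓝 ((a, b) : ℝ × ℝ), ¬ (0 < α * (q.1 - a) ∧ 0 < β * (q.2 - b) ∧ F q.1 = F q.2) :=
      fun α β hα hβ => by simpa using hcon α β hα hβ
    obtain ⟨q, ⟨⟨hqa, hqb⟩, hq⟩, h1, h2, h3, h4⟩ := (hne.and_eventually
      ((h 1 1 (by simp) (by simp)).and ((h 1 (-1) (by simp) (by simp)).and
        ((h (-1) 1 (by simp) (by simp)).and (h (-1) (-1) (by simp) (by simp)))))).exists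
    rcases hqa.lt_or_gt with ha | ha <;> rcases hqb.lt_or_gt with hb | hb
    · exact h4 ⟨by linarith, by linarith, hq⟩
    · exact h3 ⟨by linarith, by linarith, hq⟩
    · exact h2 ⟨by linarith, by linarith, hq⟩
    · exact h1 ⟨by linarith, by linarith, hq⟩
  obtain ⟨α, β, hα, hβ, hq⟩ := hsign
  have han : ∀ (c α : ℝ), AnalyticAt ℂ F c → AnalyticAt ℂ (fun z : ℂ => F (c + α * z) - F a) 0 :=
    fun c α hc => (AnalyticAt.fun_comp (f := fun z : ℂ => c + α * z) (by simpa using hc)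
      (by fun_prop)).sub analyticAt_const
  have hinj : ∀ (c α : ℝ), (α = 1 ∨ α = -1) → ∀ ε > 0,
      InjOn (fun t : ℝ => F t) (Ioo (c - ε) (c + ε)) →
      ∃ ε > 0, InjOn (fun t : ℝ => F (c + α * t) - F a) (Ioo (-ε) ε) := by
    intro c α hα ε hε hi
    refine ⟨ε, hε, fun x hx y hy hxy => ?_⟩
    have hmem : ∀ x ∈ Ioo (-ε) ε, c + α * x ∈ Ioo (c - ε) (c + ε) := by
      intro x hx
      rcases hα with rfl | rfl <;> constructor <;> linarith [hx.1, hx.2]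
    have := hi (hmem x hx) (hmem y hy) (by simpa using hxy)
    rcases hα with rfl | rfl <;> linarith
  obtain ⟨σ, hσ, hbr⟩ := exists_localBranch_zero (han a α hFa) (han b β hFb) (by simp)
    (by simp [hab]) (hinj a α hα εa hεa hia) (hinj b β hβ εb hεb hib) (by
      intro δ hδ
      obtain ⟨q, ⟨h1, h2, h3⟩, h4⟩ := (hq.and_eventually (Metric.ball_mem_nhds _ hδ)).exists
      rw [Prod.dist_eq, max_lt_iff, Real.dist_eq, Real.dist_eq,
        abs_lt, abs_lt] at h4
      refine ⟨α * (q.1 - a), ⟨h1, ?_⟩, β * (q.2 - b), ⟨h2, ?_⟩, ?_⟩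
      · rcases hα with rfl | rfl <;> linarith [h4.1.1, h4.1.2]
      · rcases hβ with rfl | rfl <;> linarith [h4.2.1, h4.2.2]
      · rcases hα with rfl | rfl <;> rcases hβ with rfl | rfl <;> simp [h3])
  refine ⟨σ * α * β, ?_, LocalBranch.of_affine hα hβ ?_⟩
  · rcases hσ with rfl | rfl <;> rcases hα with rfl | rfl <;> rcases hβ with rfl | rfl <;> simp
  · obtain ⟨ε, hε, φ, hc, h0, hmono, heq⟩ := hbr
    exact ⟨ε, hε, φ, hc, h0, hmono, fun x hx => by simpa using heq x hx⟩

lemma LocalBranch.exists_mem {E : Type*} {f : ℝ → E} {σ a b : ℝ} (h : LocalBranch f f σ a b)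
    (hab : a ≠ b) {δ : ℝ} (hδ : 0 < δ) :
    (∃ s t, s ∈ Ioo a (a + δ) ∧ t ∈ Ioo (b - δ) (b + δ) ∧ 0 < σ * (t - b) ∧ s ≠ t ∧
      LocalBranch f f σ s t) ∧
    ∃ s t, s ∈ Ioo (a - δ) a ∧ t ∈ Ioo (b - δ) (b + δ) ∧ 0 < σ * (b - t) ∧ s ≠ t ∧
      LocalBranch f f σ s t := by
  obtain ⟨ε, hε, φ, hc, rfl, hmono, heq⟩ := h
  have haI : Ioo (a - ε) (a + ε) ∈ 𝓝 a := Ioo_mem_nhds (by linarith) (by linarith)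
  have ha : a ∈ Ioo (a - ε) (a + ε) := mem_of_mem_nhds haI
  have hca : ContinuousAt φ a := hc.continuousAt haI
  have hbr : ∀ s ∈ Ioo (a - ε) (a + ε), LocalBranch f f σ s (φ s) := by
    intro s hs
    set η := min (s - (a - ε)) (a + ε - s)
    have hη : 0 < η := lt_min (by linarith [hs.1]) (by linarith [hs.2])
    have hsub : Ioo (s - η) (s + η) ⊆ Ioo (a - ε) (a + ε) := fun x hx =>
      ⟨by linarith [hx.1, min_le_left (s - (a - ε)) (a + ε - s)],
        by linarith [hx.2, min_le_right (s - (a - ε)) (a + ε - s)]⟩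
    exact ⟨η, hη, φ, hc.mono hsub, rfl, fun x hx y hy => hmono x (hsub hx) y (hsub hy),
      fun x hx => heq x (hsub hx)⟩
  have hev : ∀ᶠ s in 𝓝 a, (s ∈ Ioo (a - ε) (a + ε) ∧ φ s ∈ Ioo (φ a - δ) (φ a + δ)) ∧ s ≠ φ s :=
    (Eventually.and haI (hca.eventually (Ioo_mem_nhds (by linarith) (by linarith)))).and
      (continuousAt_id.ne_iff_eventually_ne hca |>.1 hab)
  constructor
  · obtain ⟨s, ⟨⟨h1, h2⟩, h3⟩, h4⟩ := ((hev.filter_mono nhdsWithin_le_nhds).and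
      (Ioo_mem_nhdsGT (show a < a + δ by linarith))).exists
    exact ⟨s, φ s, h4, h2, hmono a ha s h1 h4.1, h3, hbr s h1⟩
  · obtain ⟨s, ⟨⟨h1, h2⟩, h3⟩, h4⟩ := ((hev.filter_mono nhdsWithin_le_nhds).and
      (Ioo_mem_nhdsLT (show a - δ < a by linarith))).exists
    exact ⟨s, φ s, h4, h2, hmono s h1 a ha h4.2, h3, hbr s h1⟩

lemma LocalBranch.eq_apply {E : Type*} {f : ℝ → E} {σ a b : ℝ} (h : LocalBranch f f σ a b) :
    f a = f b := by
  obtain ⟨ε, hε, φ, -, rfl, -, heq⟩ := h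
  exact heq a ⟨by linarith, by linarith⟩

/-- Near a point carrying a branch, the secants of the coincidence set have the sign of that
branch. -/
lemma LocalBranch.eventually_secant {E : Type*} {f : ℝ → E} {σ a b : ℝ}
    (h : LocalBranch f f σ a b) (hib : ∃ ε > (0 : ℝ), InjOn f (Ioo (b - ε) (b + ε))) :
    ∃ δ > 0, ∀ s ∈ Ioo (a - δ) (a + δ), ∀ t ∈ Ioo (b - δ) (b + δ), ∀ s' ∈ Ioo (a - δ) (a + δ),
      ∀ t' ∈ Ioo (b - δ) (b + δ), f s = f t → f s' = f t' → s < s' → 0 < σ * (t' - t) := by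
  obtain ⟨ε, hε, φ, hc, rfl, hmono, heq⟩ := h
  obtain ⟨η, hη, hib⟩ := hib
  have haI : Ioo (a - ε) (a + ε) ∈ 𝓝 a := Ioo_mem_nhds (by linarith) (by linarith)
  have hev : ∀ᶠ s in 𝓝 a, s ∈ Ioo (a - ε) (a + ε) ∧ φ s ∈ Ioo (φ a - η) (φ a + η) :=
    Eventually.and haI
      ((hc.continuousAt haI).eventually (Ioo_mem_nhds (by linarith) (by linarith)))
  obtain ⟨δ, hδ, hb⟩ := Metric.eventually_nhds_iff_ball.1 hev
  rw [Real.ball_eq_Ioo] at hb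
  have hgraph : ∀ s ∈ Ioo (a - min δ η) (a + min δ η), ∀ t ∈ Ioo (φ a - min δ η) (φ a + min δ η),
      f s = f t → s ∈ Ioo (a - ε) (a + ε) ∧ t = φ s := by
    intro s hs t ht hst
    have h1 := hb s ⟨by linarith [hs.1, min_le_left δ η], by linarith [hs.2, min_le_left δ η]⟩
    refine ⟨h1.1, hib ⟨?_, ?_⟩ h1.2 (hst.symm.trans (heq s h1.1))⟩
    · linarith [ht.1, min_le_right δ η]
    · linarith [ht.2, min_le_right δ η]
  refine ⟨min δ η, lt_min hδ hη, fun s hs t ht s' hs' t' ht' hst hst' hss => ?_⟩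
  obtain ⟨h1, rfl⟩ := hgraph s hs t ht hst
  obtain ⟨h2, rfl⟩ := hgraph s' hs' t' ht' hst'
  exact hmono s h1 s' h2 hss

/-- The coincidence set of a continuous locally injective map is closed. -/
lemma isClosed_coincidence {E : Type*} [TopologicalSpace E] [T2Space E] {f : ℝ → E}
    (hf : Continuous f) (hi : ∀ a : ℝ, ∃ ε > (0 : ℝ), InjOn f (Ioo (a - ε) (a + ε))) :
    IsClosed {p : ℝ × ℝ | p.1 ≠ p.2 ∧ f p.1 = f p.2} := by
  have heq : IsClosed {p : ℝ × ℝ | f p.1 = f p.2} := isClosed_eq (by fun_prop) (by fun_prop)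
  refine isClosed_of_closure_subset fun p hp => ?_
  have hp' : f p.1 = f p.2 := closure_minimal (fun q hq => hq.2) heq hp
  suffices h : p.1 ≠ p.2 from ⟨h, hp'⟩
  intro hpp
  obtain ⟨ε, hε, hi⟩ := hi p.1
  have hnear : ∀ᶠ q in 𝓝 p, q.1 ∈ Ioo (p.1 - ε) (p.1 + ε) ∧ q.2 ∈ Ioo (p.1 - ε) (p.1 + ε) :=
    (continuous_fst.continuousAt.eventually (Ioo_mem_nhds (by linarith) (by linarith))).and
      (continuous_snd.continuousAt.eventually (Ioo_mem_nhds (by linarith) (by linarith)))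
  obtain ⟨q, ⟨hq1, hq2⟩, hq⟩ := ((mem_closure_iff_frequently.1 hp).and_eventually hnear).exists
  exact hq1 (hi hq.1 hq.2 hq2)

lemma isClosed_localBranch {E : Type*} [TopologicalSpace E] [T2Space E] {f : ℝ → E}
    (hf : Continuous f) (hi : ∀ a : ℝ, ∃ ε > (0 : ℝ), InjOn f (Ioo (a - ε) (a + ε)))
    (hloc : ∀ a b : ℝ, f a = f b → (∃ᶠ q in 𝓝[≠] ((a, b) : ℝ × ℝ), f q.1 = f q.2) →
      ∃ σ : ℝ, (σ = 1 ∨ σ = -1) ∧ LocalBranch f f σ a b) {σ : ℝ} (hσ : σ = 1 ∨ σ = -1) :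
    IsClosed {p : ℝ × ℝ | p.1 ≠ p.2 ∧ LocalBranch f f σ p.1 p.2} := by
  refine isClosed_of_closure_subset fun p hp => ?_
  have hsub : {p : ℝ × ℝ | p.1 ≠ p.2 ∧ LocalBranch f f σ p.1 p.2} ⊆
      {p : ℝ × ℝ | p.1 ≠ p.2 ∧ f p.1 = f p.2} := fun q hq => ⟨hq.1, hq.2.eq_apply⟩
  have hpZ := closure_minimal hsub (isClosed_coincidence hf hi) hp
  refine ⟨hpZ.1, ?_⟩
  by_contra hnot
  have hfr := mem_closure_iff_frequently.1 hp
  have hfr' : ∃ᶠ q in 𝓝[≠] p, f q.1 = f q.2 := by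
    rw [frequently_nhdsWithin_iff]
    exact hfr.mono fun q hq => ⟨hq.2.eq_apply, fun hqp => hnot (hqp ▸ hq.2)⟩
  obtain ⟨τ, hτ, hbr⟩ := hloc p.1 p.2 hpZ.2 hfr'
  have hστ : τ * σ = -1 := by
    rcases hσ with rfl | rfl <;> rcases hτ with rfl | rfl <;> simp_all
  obtain ⟨δ, hδ, hsec⟩ := hbr.eventually_secant (hi p.2)
  obtain ⟨q, ⟨hq, hqb⟩, hqδ⟩ := (hfr.and_eventually
    (Metric.ball_mem_nhds p (half_pos hδ))).exists
  rw [Prod.dist_eq, max_lt_iff, Real.dist_eq, Real.dist_eq,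
    abs_lt, abs_lt] at hqδ
  obtain ⟨⟨h1, h2⟩, h3, h4⟩ := hqδ
  obtain ⟨⟨s, t, hs, ht, hst, -, hb⟩, -⟩ := hqb.exists_mem hq (half_pos hδ)
  have := hsec q.1 ⟨by linarith, by linarith⟩ q.2 ⟨by linarith, by linarith⟩
    s ⟨by linarith [hs.1], by linarith [hs.2]⟩ t ⟨by linarith [ht.1], by linarith [ht.2]⟩
    hqb.eq_apply hb.eq_apply hs.1
  rcases hσ with rfl | rfl <;> rcases hτ with rfl | rfl <;> linarith

lemma bddAbove_norm_Ici_of_accumulation {E : Type*} [SeminormedAddCommGroup E] {f : ℝ → E}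
    (hf : Continuous f) {A : Set (ℝ × ℝ)} (hA : IsClosed A) (hne : ∀ p ∈ A, p.1 ≠ p.2)
    (heq : ∀ p ∈ A, f p.1 = f p.2)
    (hacc : ∀ p ∈ A, ∀ δ > 0, ∃ q ∈ A, q.1 ∈ Ioo p.1 (p.1 + δ) ∧ q.2 ∈ Ioo p.2 (p.2 + δ))
    {p : ℝ × ℝ} (hp : p ∈ A) (hlt : p.1 < p.2) : ∃ C, ∀ t ≥ p.1, ‖f t‖ ≤ C := by
  have hret : ∀ t ≥ p.2, ∃ s ∈ Ico p.1 t, f s = f t := by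
    intro t ht
    set T : Set ℝ := {t | ∃ s ∈ Icc p.1 t, (s, t) ∈ A}
    have hcl : IsClosed (T ∩ Icc p.2 t) := by
      have hK : IsCompact ((Icc p.1 t ×ˢ Icc p.2 t) ∩ (A ∩ {q : ℝ × ℝ | q.1 ≤ q.2})) :=
        (isCompact_Icc.prod isCompact_Icc).inter_right
          (hA.inter (isClosed_le continuous_fst continuous_snd))
      convert (hK.image continuous_snd).isClosed using 1
      ext u
      constructor
      · rintro ⟨⟨s, hs, hsu⟩, hu⟩
        exact ⟨(s, u), ⟨⟨⟨hs.1, hs.2.trans hu.2⟩, hu⟩, hsu, hs.2⟩, rfl⟩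
      · rintro ⟨⟨s, u⟩, ⟨⟨hs, hu⟩, hsu, hle⟩, rfl⟩
        exact ⟨⟨s, ⟨hs.1, hle⟩, hsu⟩, hu⟩
    have hsub := hcl.Icc_subset_of_forall_exists_gt (⟨p.1, ⟨le_rfl, hlt.le⟩, hp⟩ : p.2 ∈ T) (by
      rintro u ⟨⟨s, hs, hsu⟩, -⟩ y hy
      have hsu' : s < u := lt_of_le_of_ne hs.2 (hne _ hsu)
      have hy : u < y := hy
      obtain ⟨q, hq, hq1, hq2⟩ := hacc _ hsu (min (u - s) (y - u))
        (lt_min (by linarith) (by linarith))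
      have h1 := min_le_left (u - s) (y - u)
      have h2 := min_le_right (u - s) (y - u)
      simp only [mem_Ioo] at hq1 hq2
      exact ⟨q.2, ⟨q.1, ⟨by linarith [hs.1], by linarith⟩, hq⟩, hq2.1, by linarith⟩)
    obtain ⟨s, hs, hst⟩ := hsub ⟨ht, le_rfl⟩
    exact ⟨s, ⟨hs.1, lt_of_le_of_ne hs.2 (hne _ hst)⟩, heq _ hst⟩
  obtain ⟨m, -, hm⟩ := isCompact_Icc.exists_isMaxOn (nonempty_Icc.2 hlt.le)
    hf.norm.continuousOn
  refine ⟨‖f m‖, fun t ht => ?_⟩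
  rcases lt_or_ge t p.2 with htp | htp
  · exact hm ⟨ht, htp.le⟩
  have hK : IsCompact (Icc p.1 t ∩ {x | ‖f t‖ ≤ ‖f x‖}) :=
    isCompact_Icc.inter_right (isClosed_le continuous_const hf.norm)
  obtain ⟨x, ⟨hx, hxt⟩, hmin⟩ := hK.exists_isLeast ⟨t, ⟨ht, le_rfl⟩, le_refl ‖f t‖⟩
  have hxp : x < p.2 := by
    by_contra! hxp
    obtain ⟨s, hs, hsx⟩ := hret x hxp
    have : x ≤ s := hmin ⟨⟨hs.1, hs.2.le.trans hx.2⟩, by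
      rw [mem_ofPred_eq, hsx]
      exact hxt⟩
    exact absurd hs.2 this.not_gt
  exact hxt.trans (hm ⟨hx.1, hxp.le⟩)

lemma not_lt_of_accumulation_antitone {A : Set (ℝ × ℝ)} (hA : IsClosed A)
    (hne : ∀ p ∈ A, p.1 ≠ p.2)
    (hacc : ∀ p ∈ A, ∀ δ > 0, ∃ q ∈ A, q.1 ∈ Ioo p.1 (p.1 + δ) ∧ q.2 ∈ Ioo (p.2 - δ) p.2)
    {p : ℝ × ℝ} (hp : p ∈ A) : ¬ p.1 < p.2 := by
  intro hlt
  have hK : IsCompact ((Icc p.1 p.2 ×ˢ Icc p.1 p.2) ∩ (A ∩ {q : ℝ × ℝ | q.1 ≤ q.2})) :=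
    (isCompact_Icc.prod isCompact_Icc).inter_right
      (hA.inter (isClosed_le continuous_fst continuous_snd))
  obtain ⟨q, ⟨⟨hq1, hq2⟩, hqA, hle⟩, hmin⟩ := hK.exists_isMinOn
    ⟨p, ⟨⟨le_rfl, hlt.le⟩, hlt.le, le_rfl⟩, hp, hlt.le⟩
    (f := fun q : ℝ × ℝ => q.2 - q.1) (by fun_prop)
  have hq : q.1 < q.2 := lt_of_le_of_ne hle (hne q hqA)
  obtain ⟨r, hr, hr1, hr2⟩ := hacc q hqA ((q.2 - q.1) / 2) (by linarith)
  simp only [mem_Icc, mem_Ioo] at hq1 hq2 hr1 hr2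
  have : q.2 - q.1 ≤ r.2 - r.1 := hmin
    ⟨⟨⟨by linarith, by linarith⟩, by linarith, by linarith⟩, hr,
      show r.1 ≤ r.2 by linarith⟩
  linarith

/-- If the coincidence set of `f` has an increasing branch, then `f` is bounded. -/
lemma bounded_of_accumulation_monotone {E : Type*} [SeminormedAddCommGroup E] {f : ℝ → E}
    (hf : Continuous f) {A : Set (ℝ × ℝ)} (hA : IsClosed A) (hne : ∀ p ∈ A, p.1 ≠ p.2)
    (heq : ∀ p ∈ A, f p.1 = f p.2)
    (hr : ∀ p ∈ A, ∀ δ > 0, ∃ q ∈ A, q.1 ∈ Ioo p.1 (p.1 + δ) ∧ q.2 ∈ Ioo p.2 (p.2 + δ))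
    (hl : ∀ p ∈ A, ∀ δ > 0, ∃ q ∈ A, q.1 ∈ Ioo (p.1 - δ) p.1 ∧ q.2 ∈ Ioo (p.2 - δ) p.2)
    (hA0 : A.Nonempty) : ∃ C, ∀ t, ‖f t‖ ≤ C := by
  obtain ⟨p, hp⟩ := hA0
  wlog hlt : p.1 < p.2 generalizing A p
  · refine this (A := Prod.swap ⁻¹' A) (hA.preimage continuous_swap)
      (fun q hq => (hne _ hq).symm) (fun q hq => (heq _ hq).symm) ?_ ?_ p.swap (by simpa) ?_
    · intro q hq δ hδ
      obtain ⟨r, hrA, h1, h2⟩ := hr _ hq δ hδ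
      exact ⟨r.swap, by simpa, h2, h1⟩
    · intro q hq δ hδ
      obtain ⟨r, hrA, h1, h2⟩ := hl _ hq δ hδ
      exact ⟨r.swap, by simpa, h2, h1⟩
    · exact lt_of_le_of_ne (not_lt.1 hlt) (hne p hp).symm
  obtain ⟨C, hC⟩ := bddAbove_norm_Ici_of_accumulation hf hA hne heq hr hp hlt
  obtain ⟨D, hD⟩ := bddAbove_norm_Ici_of_accumulation (f := fun t => f (-t)) (by fun_prop)
    (A := (fun q : ℝ × ℝ => (-q.2, -q.1)) ⁻¹' A) (hA.preimage (by fun_prop))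
    (fun q hq h => hne _ hq (by simp [h])) (fun q hq => (heq _ hq).symm) (by
      intro q hq δ hδ
      obtain ⟨r, hrA, h1, h2⟩ := hl _ hq δ hδ
      simp only [mem_Ioo] at h1 h2
      refine ⟨(-r.2, -r.1), by simpa, ⟨?_, ?_⟩, ?_, ?_⟩ <;> simp only <;> linarith)
    (p := (-p.2, -p.1)) (by simpa) (by simpa)
  refine ⟨max C D, fun t => ?_⟩
  rcases le_total p.1 t with h | h
  · exact (hC t h).trans (le_max_left _ _)
  · have := hD (-t) (by simp only [ge_iff_le, neg_le_neg_iff]; linarith)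
    rw [neg_neg] at this
    exact this.trans (le_max_right _ _)

theorem countable_self_intersections_of_unbounded
    (F : ℂ → ℂ) (U : Set ℂ) (hU : IsOpen U) (hRU : ∀ x : ℝ, (x : ℂ) ∈ U)
    (hF : AnalyticOnNhd ℂ F U)
    (hinj : ∀ a : ℝ, ∃ ε > (0:ℝ),
      Set.InjOn (fun t : ℝ => F t) (Ioo (a - ε) (a + ε)))
    (hunb : ¬ ∃ C : ℝ, ∀ t : ℝ, ‖F t‖ ≤ C) :
    Set.Countable {p : ℝ × ℝ | p.1 ≠ p.2 ∧ F p.1 = F p.2} := by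
  set f : ℝ → ℂ := fun t => F t
  have hFa : ∀ x : ℝ, AnalyticAt ℂ F x := fun x => hF x (hRU x)
  have hf : Continuous f := continuous_iff_continuousAt.2 fun x =>
    (hFa x).continuousAt.comp Complex.continuous_ofReal.continuousAt
  have hloc : ∀ a b : ℝ, f a = f b → (∃ᶠ q in 𝓝[≠] ((a, b) : ℝ × ℝ), f q.1 = f q.2) →
      ∃ σ : ℝ, (σ = 1 ∨ σ = -1) ∧ LocalBranch f f σ a b := fun a b hab hfr =>
    exists_localBranch (hFa a) (hFa b) (hinj a) (hinj b) hab hfr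
  have hempty : ∀ σ : ℝ, (σ = 1 ∨ σ = -1) →
      ∀ p : ℝ × ℝ, ¬ (p.1 ≠ p.2 ∧ LocalBranch f f σ p.1 p.2) := by
    intro σ hσ p hp
    have hA := isClosed_localBranch hf hinj hloc hσ
    rcases hσ with rfl | rfl
    · refine hunb (bounded_of_accumulation_monotone hf hA (fun q hq => hq.1)
        (fun q hq => hq.2.eq_apply) ?_ ?_ ⟨p, hp⟩)
      · intro q hq δ hδ
        obtain ⟨⟨s, t, hs, ht, hst, hne, hb⟩, -⟩ := hq.2.exists_mem hq.1 hδ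
        exact ⟨(s, t), ⟨hne, hb⟩, hs, by linarith, ht.2⟩
      · intro q hq δ hδ
        obtain ⟨-, s, t, hs, ht, hst, hne, hb⟩ := hq.2.exists_mem hq.1 hδ
        exact ⟨(s, t), ⟨hne, hb⟩, hs, ht.1, by linarith⟩
    · rcases hp.1.lt_or_gt with hlt | hlt
      · refine not_lt_of_accumulation_antitone hA (fun q hq => hq.1) ?_ hp hlt
        intro q hq δ hδ
        obtain ⟨⟨s, t, hs, ht, hst, hne, hb⟩, -⟩ := hq.2.exists_mem hq.1 hδ
        exact ⟨(s, t), ⟨hne, hb⟩, hs, ht.1, by linarith⟩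
      · refine not_lt_of_accumulation_antitone (hA.preimage continuous_swap)
          (fun q hq => hq.1.symm) ?_ (p := p.swap) hp hlt
        intro q hq δ hδ
        obtain ⟨-, s, t, hs, ht, hst, hne, hb⟩ := hq.2.exists_mem hq.1 hδ
        refine ⟨(t, s), ⟨hne, hb⟩, ⟨?_, ht.2⟩, hs⟩
        simp only [Prod.snd_swap] at hst
        linarith
  have hdisc : DiscreteTopology {p : ℝ × ℝ | p.1 ≠ p.2 ∧ F p.1 = F p.2} := by
    rw [discreteTopology_subtype_iff]
    intro p hp
    by_contra hacc
    have hacc : AccPt p (𝓟 {p : ℝ × ℝ | p.1 ≠ p.2 ∧ F p.1 = F p.2}) := ⟨hacc⟩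
    obtain ⟨σ, hσ, hb⟩ := hloc p.1 p.2 hp.2
      ((accPt_iff_frequently_nhdsNE.1 hacc).mono fun q hq => hq.2)
    exact hempty σ hσ p ⟨hp.1, hb⟩
  exact Set.countable_coe_iff.1 (TopologicalSpace.separableSpace_iff_countable.1 inferInstance)
end

section
/- The curve t ↦ ζ(1/2 + it) is locally injective on ℝ: for every real t there exists an open real interval containing t on which the function is injective. -/
open Complex

/-- Derivative of the phase of the `n`-th Euler approximant to `Gammaℝ (1/2 + 2 * y * I)`. -/
noncomputable def phaseDeriv (n : ℕ) (y : ℝ) : ℝ :=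
  Real.log n - Real.log Real.pi
    - ∑ j ∈ Finset.range (n + 1), ((j : ℝ) + 1/4) / (((j : ℝ) + 1/4) ^ 2 + y ^ 2)

/-- Logarithm, up to a real constant, of the `n`-th Euler approximant to `Gammaℝ (2 * z)`. -/
noncomputable def logApprox (n : ℕ) (z : ℂ) : ℂ :=
  z * Real.log n - z * Real.log Real.pi - ∑ j ∈ Finset.range (n + 1), log (z + j)

lemma hasDerivAt_logApprox_im (n : ℕ) (y : ℝ) :
    HasDerivAt (fun y : ℝ => (logApprox n (1/4 + y * I)).im) (phaseDeriv n y) y := by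
  have hz : HasDerivAt (fun y : ℝ => (1/4 + y * I : ℂ)) I y := by
    simpa using ((hasDerivAt_id y).ofReal_comp.mul_const I).const_add (1/4 : ℂ)
  have hj : ∀ j ∈ Finset.range (n + 1), HasDerivAt (fun y : ℝ => log (1/4 + y * I + j))
      (I / (1/4 + y * I + j)) y := fun j _ => by
    refine (hz.add_const (j : ℂ)).clog_real (Or.inl ?_)
    simp
    positivity
  have h := ((hz.mul_const (Real.log n : ℂ)).sub (hz.mul_const (Real.log Real.pi : ℂ))).sub
    (HasDerivAt.fun_sum hj)
  have h2 := (imCLM.hasFDerivAt (x := logApprox n (1/4 + y * I))).comp_hasDerivAt y h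
  refine h2.congr_deriv ?_
  have key : ∀ j : ℕ, (I / (1/4 + y * I + j)).im
      = ((j : ℝ) + 1/4) / (((j : ℝ) + 1/4) ^ 2 + y ^ 2) := fun j => by
    simp [div_im, normSq_apply]
    ring
  simp only [imCLM_apply, sub_im, im_sum, key, phaseDeriv]
  simp only [mul_im, I_re, I_im, ofReal_re, ofReal_im]
  ring

lemma GammaSeq_eq_exp_logApprox {n : ℕ} (hn : n ≠ 0) {z : ℂ} (hz : 0 < z.re) :
    (Real.pi : ℂ) ^ (-z) * GammaSeq z n = n.factorial * exp (logApprox n z) := by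
  have hj : ∀ j : ℕ, z + j ≠ 0 := fun j h => by
    have := congrArg re h
    simp at this
    have : (0:ℝ) ≤ j := by positivity
    linarith
  rw [GammaSeq, logApprox, exp_sub, exp_sub, exp_sum, Finset.prod_congr rfl fun j _ => exp_log (hj j),
    cpow_def_of_ne_zero (by exact_mod_cast Real.pi_ne_zero), cpow_def_of_ne_zero (by exact_mod_cast hn),
    ← ofReal_log Real.pi_nonneg, mul_neg, exp_neg, natCast_log, mul_comm _ z, mul_comm _ z]
  ring

lemma tendsto_logApprox {z : ℂ} (hz : 0 < z.re) :
    Filter.Tendsto (fun n : ℕ => n.factorial * exp (logApprox n z)) Filter.atTop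
      (nhds (Gammaℝ (2 * z))) := by
  have h := (GammaSeq_tendsto_Gamma z).const_mul ((Real.pi : ℂ) ^ (-z))
  have e : Gammaℝ (2 * z) = (Real.pi : ℂ) ^ (-z) * Gamma z := by
    rw [Gammaℝ_def]; congr 2 <;> ring
  rw [e]
  refine h.congr' ?_
  filter_upwards [Filter.eventually_ne_atTop 0] with n hn
  exact GammaSeq_eq_exp_logApprox hn hz

lemma mul_le_half_log {a Y : ℝ} (ha : 0 < a) (hY : 0 < Y) :
    a / (a ^ 2 + 1/4 + Y) ≤ Real.log ((a + 1/2) ^ 2 + Y) / 2 - Real.log ((a - 1/2) ^ 2 + Y) / 2 := by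
  have hu : 0 < a ^ 2 + 1/4 + Y := by positivity
  have h := Real.sum_range_le_log_div (x := a / (a ^ 2 + 1/4 + Y)) (by positivity)
    (by rw [div_lt_one hu]; nlinarith [sq_nonneg (a - 1/2)]) 1
  have h1 : (1 + a / (a ^ 2 + 1/4 + Y)) / (1 - a / (a ^ 2 + 1/4 + Y))
      = ((a + 1/2) ^ 2 + Y) / ((a - 1/2) ^ 2 + Y) := by
    have : (a - 1/2) ^ 2 + Y ≠ 0 := by positivity
    have : a ^ 2 + 1/4 + Y - a ≠ 0 := by
      convert this using 1; ring
    rw [div_eq_div_iff (by rw [one_sub_div hu.ne']; positivity) (by assumption)]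
    field_simp
    ring
  rw [h1, Real.log_div (by positivity) (by positivity)] at h
  simp at h
  norm_num at h ⊢
  linarith

lemma half_log_le_mul {a Y : ℝ} (ha : 0 < a) (hY : 3/4 ≤ Y) :
    Real.log ((a + 1/2) ^ 2 + Y) / 2 - Real.log ((a - 1/2) ^ 2 + Y) / 2 ≤ a / (a ^ 2 + Y - 3/4) := by
  have hu : 0 < a ^ 2 + 1/4 + Y := by positivity
  have hlt : a / (a ^ 2 + 1/4 + Y) < 1 := by
    rw [div_lt_one hu]; nlinarith [sq_nonneg (a - 1/2)]
  have h := Real.log_div_le_sum_range_add (x := a / (a ^ 2 + 1/4 + Y)) (by positivity) hlt 0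
  have hne : a ^ 2 + 1/4 + Y - a ≠ 0 := by nlinarith [sq_nonneg (a - 1/2)]
  have h1 : (1 + a / (a ^ 2 + 1/4 + Y)) / (1 - a / (a ^ 2 + 1/4 + Y))
      = ((a + 1/2) ^ 2 + Y) / ((a - 1/2) ^ 2 + Y) := by
    rw [div_eq_div_iff (by rw [one_sub_div hu.ne']; positivity) (by positivity)]
    field_simp
    ring
  rw [h1, Real.log_div (by positivity) (by positivity)] at h
  have h2 : a / (a ^ 2 + 1/4 + Y) / (1 - (a / (a ^ 2 + 1/4 + Y)) ^ 2) ≤ a / (a ^ 2 + Y - 3/4) := by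
    have h3 : 0 < (a ^ 2 + 1/4 + Y) ^ 2 - a ^ 2 := by
      nlinarith [sq_nonneg (a - 1/2), sq_nonneg a]
    have h4 : 0 < a ^ 2 + Y - 3/4 := by nlinarith
    have : a / (a ^ 2 + 1/4 + Y) / (1 - (a / (a ^ 2 + 1/4 + Y)) ^ 2)
        = a * (a ^ 2 + 1/4 + Y) / ((a ^ 2 + 1/4 + Y) ^ 2 - a ^ 2) := by
      rw [div_pow, one_sub_div (by positivity)]
      field_simp
    rw [this, div_le_div_iff₀ h3 h4]
    nlinarith [mul_nonneg ha.le (by linarith : 0 ≤ 1/4 + Y)]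
  simp at h
  norm_num at h h2 ⊢
  linarith

lemma sum_half_log (Y : ℝ) (n : ℕ) :
    ∑ j ∈ Finset.range (n + 1), (Real.log (((j : ℝ) + 1/4 + 1/2) ^ 2 + Y) / 2
      - Real.log (((j : ℝ) + 1/4 - 1/2) ^ 2 + Y) / 2)
      = Real.log (((n : ℝ) + 3/4) ^ 2 + Y) / 2 - Real.log (1/16 + Y) / 2 := by
  have h := Finset.sum_range_sub (fun j : ℕ => Real.log (((j : ℝ) - 1/4) ^ 2 + Y) / 2) (n + 1)
  have e1 : ((n + 1 : ℕ) : ℝ) - 1/4 = n + 3/4 := by push_cast; ring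
  have e2 : (((0 : ℕ) : ℝ) - 1/4) ^ 2 = 1/16 := by norm_num
  rw [e1, e2] at h
  rw [← h]
  refine Finset.sum_congr rfl fun j _ => ?_
  push_cast
  ring_nf

lemma phaseDeriv_le {n : ℕ} (hn : n ≠ 0) (y : ℝ) :
    phaseDeriv n y ≤ Real.log (y ^ 2 + 13/16) / 2 - Real.log Real.pi := by
  have h : Real.log (((n : ℝ) + 3/4) ^ 2 + (y ^ 2 + 3/4)) / 2 - Real.log (1/16 + (y ^ 2 + 3/4)) / 2
      ≤ ∑ j ∈ Finset.range (n + 1), ((j : ℝ) + 1/4) / (((j : ℝ) + 1/4) ^ 2 + y ^ 2) := by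
    rw [← sum_half_log]
    refine Finset.sum_le_sum fun j _ => ?_
    have h := half_log_le_mul (a := (j : ℝ) + 1/4) (Y := y ^ 2 + 3/4) (by positivity)
      (by nlinarith [sq_nonneg y])
    rwa [add_sub_assoc _ (y ^ 2 + 3/4), add_sub_cancel_right] at h
  have h2 : Real.log n ≤ Real.log (((n : ℝ) + 3/4) ^ 2 + (y ^ 2 + 3/4)) / 2 := by
    have : Real.log n = Real.log ((n : ℝ) ^ 2) / 2 := by rw [Real.log_pow]; push_cast; ring
    rw [this]
    gcongr
    nlinarith [sq_nonneg y, (Nat.cast_nonneg n : (0:ℝ) ≤ n)]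
  have e : 1/16 + (y ^ 2 + 3/4) = y ^ 2 + 13/16 := by ring
  rw [e] at h
  rw [phaseDeriv]
  linarith

lemma le_phaseDeriv {n : ℕ} {y : ℝ} (hy : 1/4 < y ^ 2) :
    Real.log n - Real.log (((n : ℝ) + 3/4) ^ 2 + (y ^ 2 - 1/4)) / 2
      + Real.log (y ^ 2 - 3/16) / 2 - Real.log Real.pi ≤ phaseDeriv n y := by
  have h : ∑ j ∈ Finset.range (n + 1), ((j : ℝ) + 1/4) / (((j : ℝ) + 1/4) ^ 2 + y ^ 2)
      ≤ Real.log (((n : ℝ) + 3/4) ^ 2 + (y ^ 2 - 1/4)) / 2 - Real.log (1/16 + (y ^ 2 - 1/4)) / 2 := by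
    rw [← sum_half_log]
    refine Finset.sum_le_sum fun j _ => ?_
    have h := mul_le_half_log (a := (j : ℝ) + 1/4) (Y := y ^ 2 - 1/4) (by positivity)
      (by linarith)
    rwa [add_assoc _ (1/4) (y ^ 2 - 1/4), add_sub_cancel] at h
  have e : 1/16 + (y ^ 2 - 1/4) = y ^ 2 - 3/16 := by ring
  rw [e] at h
  rw [phaseDeriv]
  linarith

lemma neg_le_phaseDeriv (n : ℕ) (y : ℝ) : -5 - Real.log Real.pi ≤ phaseDeriv n y := by
  have h : ∑ j ∈ Finset.range (n + 1), ((j : ℝ) + 1/4) / (((j : ℝ) + 1/4) ^ 2 + y ^ 2)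
      ≤ (1 + Real.log n) + 4 := by
    rw [Finset.sum_range_succ']
    refine add_le_add ?_ ?_
    · refine le_trans ?_ (harmonic_le_one_add_log n)
      rw [harmonic]
      push_cast
      refine Finset.sum_le_sum fun j _ => ?_
      rw [inv_eq_one_div, div_le_div_iff₀ (by positivity) (by positivity)]
      nlinarith [sq_nonneg y, (Nat.cast_nonneg j : (0:ℝ) ≤ j)]
    · rw [div_le_iff₀ (by positivity)]
      norm_num
      nlinarith [sq_nonneg y]
  rw [phaseDeriv]
  linarith

lemma im_mul_conj_Gammaℝ_ne_zero {y₁ y₂ c C : ℝ} (hy : y₁ < y₂) (hc : 0 < c)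
    (hC : C * (y₂ - y₁) ≤ Real.pi / 2)
    (h : ∀ᶠ n : ℕ in Filter.atTop, ∀ y ∈ Set.Ioo y₁ y₂,
      c ≤ |phaseDeriv n y| ∧ |phaseDeriv n y| ≤ C) :
    (Gammaℝ (2 * (1/4 + y₂ * I)) * (starRingEnd ℂ) (Gammaℝ (2 * (1/4 + y₁ * I)))).im ≠ 0 := by
  have hre : ∀ y : ℝ, 0 < (1/4 + y * I : ℂ).re := fun y => by simp
  set W : ℕ → ℝ → ℂ := fun n y => n.factorial * exp (logApprox n (1/4 + y * I)) with hW
  set G : ℝ → ℂ := fun y => Gammaℝ (2 * (1/4 + y * I)) with hG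
  have hG0 : ∀ y, G y ≠ 0 := fun y => Gammaℝ_ne_zero_of_re_pos (by simp)
  have hlim : ∀ y, Filter.Tendsto (fun n => W n y) Filter.atTop (nhds (G y)) :=
    fun y => tendsto_logApprox (hre y)
  have hnorm : Filter.Tendsto (fun n => ‖W n y₂ * (starRingEnd ℂ) (W n y₁)‖) Filter.atTop
      (nhds ‖G y₂ * (starRingEnd ℂ) (G y₁)‖) :=
    ((hlim y₂).mul (continuous_conj.continuousAt.tendsto.comp (hlim y₁))).norm
  have him : Filter.Tendsto (fun n => |(W n y₂ * (starRingEnd ℂ) (W n y₁)).im|) Filter.atTop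
      (nhds |(G y₂ * (starRingEnd ℂ) (G y₁)).im|) :=
    (continuous_im.continuousAt.tendsto.comp
      ((hlim y₂).mul (continuous_conj.continuousAt.tendsto.comp (hlim y₁)))).abs
  have hd : 0 < y₂ - y₁ := sub_pos.mpr hy
  have hle : ∀ᶠ n : ℕ in Filter.atTop,
      ‖W n y₂ * (starRingEnd ℂ) (W n y₁)‖ * Real.sin (c * (y₂ - y₁))
        ≤ |(W n y₂ * (starRingEnd ℂ) (W n y₁)).im| := by
    filter_upwards [h] with n hn
    obtain ⟨ξ, hξ, hs⟩ := exists_hasDerivAt_eq_slope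
      (fun y : ℝ => (logApprox n (1/4 + y * I)).im) (phaseDeriv n) hy
      (fun y _ => (hasDerivAt_logApprox_im n y).continuousAt.continuousWithinAt)
      (fun y _ => hasDerivAt_logApprox_im n y)
    obtain ⟨h1, h2⟩ := hn ξ hξ
    set L : ℝ → ℂ := fun y => logApprox n (1/4 + y * I) with hL
    have hΔ : (L y₂).im - (L y₁).im = phaseDeriv n ξ * (y₂ - y₁) := by
      rw [hs, div_mul_cancel₀ _ hd.ne']
    have hprod : W n y₂ * (starRingEnd ℂ) (W n y₁)
        = ((n.factorial ^ 2 : ℝ) : ℂ) * exp (L y₂ + (starRingEnd ℂ) (L y₁)) := by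
      simp only [hW, hL, map_mul, ← exp_conj, exp_add, map_natCast]
      push_cast
      ring
    have hi : (L y₂ + (starRingEnd ℂ) (L y₁)).im = phaseDeriv n ξ * (y₂ - y₁) := by
      rw [← hΔ]; simp; ring
    rw [hprod, norm_mul, norm_exp, im_ofReal_mul, exp_im, hi, abs_mul, abs_mul,
      Real.abs_exp, norm_real, Real.norm_eq_abs, mul_assoc]
    gcongr
    have h3 : |phaseDeriv n ξ * (y₂ - y₁)| = |phaseDeriv n ξ| * (y₂ - y₁) := by
      rw [abs_mul, abs_of_pos hd]
    have h4 : |phaseDeriv n ξ| * (y₂ - y₁) ≤ Real.pi / 2 := le_trans (by gcongr) hC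
    rw [Real.abs_sin_eq_sin_abs_of_abs_le_pi (by rw [h3]; linarith [Real.pi_pos]), h3]
    refine Real.sin_le_sin_of_le_of_le_pi_div_two ?_ h4 (by gcongr)
    have : 0 < c * (y₂ - y₁) := by positivity
    linarith [Real.pi_pos]
  have hfin := le_of_tendsto_of_tendsto (hnorm.mul_const _) him hle
  have hcd : c * (y₂ - y₁) ≤ Real.pi / 2 := by
    obtain ⟨n, hn⟩ := h.exists
    obtain ⟨h1, h2⟩ := hn ((y₁ + y₂) / 2) ⟨by linarith, by linarith⟩
    exact le_trans (by gcongr; linarith) hC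
  have hsin : 0 < Real.sin (c * (y₂ - y₁)) :=
    Real.sin_pos_of_pos_of_lt_pi (by positivity) (by linarith [Real.pi_pos])
  have hpos : 0 < ‖G y₂ * (starRingEnd ℂ) (G y₁)‖ :=
    norm_pos_iff.mpr (mul_ne_zero (hG0 _) ((map_ne_zero _).mpr (hG0 _)))
  exact abs_pos.mp (lt_of_lt_of_le (by positivity) hfin)

lemma phaseDeriv_bounds_of_lt_three :
    ∃ c > 0, ∃ C, ∀ᶠ n : ℕ in Filter.atTop, ∀ y : ℝ, |y| < 3 →
      c ≤ |phaseDeriv n y| ∧ |phaseDeriv n y| ≤ C := by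
  have hpi : (157/16 : ℝ) < Real.pi ^ 2 := by nlinarith [Real.pi_gt_d4]
  have hlog : Real.log (157/16) / 2 < Real.log Real.pi := by
    have := Real.log_lt_log (by norm_num) hpi
    rw [Real.log_pow] at this
    push_cast at this
    linarith
  refine ⟨Real.log Real.pi - Real.log (157/16) / 2, by linarith, 5 + Real.log Real.pi, ?_⟩
  filter_upwards [Filter.eventually_ne_atTop 0] with n hn y hy
  have h1 := phaseDeriv_le hn y
  have h2 : Real.log (y ^ 2 + 13/16) ≤ Real.log (157/16) := by
    refine Real.log_le_log (by positivity) ?_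
    have := sq_lt_sq' (abs_lt.mp hy).1 (abs_lt.mp hy).2
    linarith
  have h3 := neg_le_phaseDeriv n y
  rw [abs_of_neg (by linarith)]
  constructor <;> linarith

lemma phaseDeriv_bounds_of_gt (R : ℝ) :
    ∃ c > 0, ∃ C, ∀ᶠ n : ℕ in Filter.atTop, ∀ y ∈ Set.Ioo (16/5) R,
      c ≤ |phaseDeriv n y| ∧ |phaseDeriv n y| ≤ C := by
  have hpi : Real.pi ^ 2 < (10 : ℝ) := by nlinarith [Real.pi_lt_d4, Real.pi_pos]
  have hlog : Real.log Real.pi < Real.log 10 / 2 := by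
    have := Real.log_lt_log (by positivity) hpi
    rw [Real.log_pow] at this
    push_cast at this
    linarith
  set c := (Real.log 10 / 2 - Real.log Real.pi) / 2 with hc
  have hlim : Filter.Tendsto (fun n : ℕ => Real.log n
      - Real.log (((n : ℝ) + 3/4) ^ 2 + R ^ 2) / 2) Filter.atTop (nhds 0) := by
    have h0 : Filter.Tendsto (fun n : ℕ => (1 + 3/4 / (n : ℝ)) ^ 2 + (R / (n : ℝ)) ^ 2)
        Filter.atTop (nhds ((1 + 0) ^ 2 + 0 ^ 2)) :=
      (((tendsto_const_div_atTop_nhds_zero_nat (3/4 : ℝ)).const_add 1).pow 2).add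
        ((tendsto_const_div_atTop_nhds_zero_nat R).pow 2)
    have h1 := ((h0.log (by norm_num)).div_const 2).neg
    norm_num at h1
    refine h1.congr' ?_
    filter_upwards [Filter.eventually_ne_atTop 0] with n hn
    have hn' : (0:ℝ) < n := by positivity
    have e : ((n : ℝ) + 3/4) ^ 2 + R ^ 2
        = (n : ℝ) ^ 2 * ((1 + 3/4 / (n : ℝ)) ^ 2 + (R / (n : ℝ)) ^ 2) := by
      field_simp
    rw [e, Real.log_mul (by positivity) (by positivity), Real.log_pow]
    push_cast
    norm_num
    ring
  refine ⟨c, by linarith, max (Real.log (R ^ 2 + 13/16) / 2) (5 + Real.log Real.pi), ?_⟩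
  filter_upwards [Filter.eventually_ne_atTop 0, hlim.eventually_const_lt (by linarith : -c < 0)]
    with n hn hn2 y hy
  have hy0 : (16/5 : ℝ) < y := hy.1
  have hyR : y ^ 2 < R ^ 2 := by
    have := hy.2
    gcongr
  have h1 := le_phaseDeriv (n := n) (y := y) (by nlinarith)
  have h2 : Real.log 10 ≤ Real.log (y ^ 2 - 3/16) := Real.log_le_log (by norm_num) (by nlinarith)
  have h3 : Real.log (((n : ℝ) + 3/4) ^ 2 + (y ^ 2 - 1/4))
      ≤ Real.log (((n : ℝ) + 3/4) ^ 2 + R ^ 2) :=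
    Real.log_le_log (by nlinarith [sq_nonneg ((n : ℝ) + 3/4)]) (by linarith)
  have h4 := phaseDeriv_le hn y
  have h5 : Real.log (y ^ 2 + 13/16) ≤ Real.log (R ^ 2 + 13/16) :=
    Real.log_le_log (by positivity) (by linarith)
  have h6 : 0 < Real.log Real.pi := Real.log_pos (by linarith [Real.pi_gt_three])
  rw [abs_of_pos (by linarith)]
  exact ⟨by linarith, le_max_of_le_left (by linarith)⟩

lemma im_mul_conj_Gammaℝ_eq_zero {t₁ t₂ : ℝ}
    (h : riemannZeta (1/2 + t₁ * I) = riemannZeta (1/2 + t₂ * I))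
    (h0 : riemannZeta (1/2 + t₁ * I) ≠ 0) :
    (Gammaℝ (1/2 + t₂ * I) * (starRingEnd ℂ) (Gammaℝ (1/2 + t₁ * I))).im = 0 := by
  have hre : ∀ t : ℝ, 0 < (1/2 + t * I : ℂ).re := fun t => by simp
  have hne : ∀ t : ℝ, (1/2 + t * I : ℂ) ≠ 0 := fun t h => by
    have := hre t
    rw [h] at this
    exact lt_irrefl _ this
  have hconj : ∀ t : ℝ, (starRingEnd ℂ) (1/2 + t * I) = 1 - (1/2 + t * I) := fun t => by
    simp [map_ofNat]; ring
  have hG0 : ∀ t : ℝ, Gammaℝ (1/2 + t * I) ≠ 0 := fun t => Gammaℝ_ne_zero_of_re_pos (hre t)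
  have hGc : ∀ s : ℂ, Gammaℝ ((starRingEnd ℂ) s) = (starRingEnd ℂ) (Gammaℝ s) := fun s => by
    rw [Gammaℝ_def, Gammaℝ_def, map_mul, ← Gamma_conj,
      cpow_def_of_ne_zero (by exact_mod_cast Real.pi_ne_zero),
      cpow_def_of_ne_zero (by exact_mod_cast Real.pi_ne_zero), ← exp_conj,
      ← ofReal_log Real.pi_nonneg]
    simp [map_ofNat]
  have hreal : ∀ t : ℝ, (starRingEnd ℂ) (Gammaℝ (1/2 + t * I) * riemannZeta (1/2 + t * I))
      = Gammaℝ (1/2 + t * I) * riemannZeta (1/2 + t * I) := fun t => by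
    have hz := riemannZeta_def_of_ne_zero (hne t)
    have hne' : (starRingEnd ℂ) (1/2 + t * I) ≠ 0 := (map_ne_zero _).mpr (hne t)
    have hz' := riemannZeta_def_of_ne_zero hne'
    rw [hGc, riemannZeta_conj, hconj, completedRiemannZeta_one_sub,
      eq_div_iff ((map_ne_zero _).mpr (hG0 t))] at hz'
    rw [eq_div_iff (hG0 t)] at hz
    rw [map_mul, mul_comm, hz', ← hz, mul_comm]
  set w := riemannZeta (1/2 + t₁ * I) with hw
  have h1 := hreal t₁
  have h2 := hreal t₂
  rw [← h] at h2
  rw [← hw] at h1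
  rw [← conj_eq_iff_im]
  have hw' : (starRingEnd ℂ) w ≠ 0 := (map_ne_zero _).mpr h0
  apply mul_right_cancel₀ (mul_ne_zero h0 hw')
  simp only [map_mul, conj_conj] at h1 h2 ⊢
  linear_combination Gammaℝ (1/2 + t₁ * I) * w * h2 - Gammaℝ (1/2 + t₂ * I) * w * h1

lemma exists_injOn_of_phaseDeriv_bounds {t₀ δ c C : ℝ} (hδ : 0 < δ) (hc : 0 < c)
    (h : ∀ᶠ n : ℕ in Filter.atTop, ∀ y ∈ Set.Ioo ((t₀ - δ) / 2) ((t₀ + δ) / 2),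
      c ≤ |phaseDeriv n y| ∧ |phaseDeriv n y| ≤ C) :
    ∃ ε > (0:ℝ), Set.InjOn (fun t : ℝ => riemannZeta (1/2 + t * I))
      (Set.Ioo (t₀ - ε) (t₀ + ε)) := by
  have hcont : Continuous (fun t : ℝ => (1/2 + t * I : ℂ)) := by fun_prop
  have hinj : Function.Injective (fun t : ℝ => (1/2 + t * I : ℂ)) := fun a b hab => by
    simpa using hab
  have hev : ∀ᶠ t : ℝ in nhds t₀, riemannZeta (1/2 + t * I) = 0 → t = t₀ := by
    by_cases hz : riemannZeta (1/2 + t₀ * I) = 0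
    · obtain ⟨u, hu, hu2⟩ := isDiscrete_iff_forall_mem_exists_isOpen.mp isDiscrete_riemannZetaZeros
        (1/2 + t₀ * I) hz
      have hmem : (1/2 + t₀ * I : ℂ) ∈ u :=
        (hu2.ge (Set.mem_singleton (1/2 + t₀ * I : ℂ))).1
      filter_upwards [hcont.continuousAt.eventually (hu.mem_nhds hmem)] with t ht ht0
      exact hinj (hu2.le ⟨ht, ht0⟩)
    · have hs : (1/2 + t₀ * I : ℂ) ≠ 1 := fun h => by
        have := congrArg re h
        norm_num at this
      have hd := (differentiableAt_riemannZeta hs).continuousAt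
      have hd' : ContinuousAt (fun t : ℝ => riemannZeta (1/2 + t * I)) t₀ :=
        ContinuousAt.comp (f := fun t : ℝ => (1/2 + t * I : ℂ)) hd hcont.continuousAt
      filter_upwards [hd'.eventually_ne hz] with t ht ht0
      exact absurd ht0 ht
  rw [Metric.eventually_nhds_iff] at hev
  obtain ⟨η, hη, hev⟩ := hev
  have hC : 0 < C := by
    obtain ⟨n, hn⟩ := h.exists
    obtain ⟨h1, h2⟩ := hn (t₀ / 2) ⟨by linarith, by linarith⟩
    linarith
  obtain ⟨ε, hε, hεm⟩ := exists_between (show 0 < min (min δ η) (Real.pi / (2 * C)) by positivity)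
  simp only [lt_min_iff] at hεm
  obtain ⟨⟨hεδ, hεη⟩, hεC⟩ := hεm
  have key : ∀ t₁ ∈ Set.Ioo (t₀ - ε) (t₀ + ε), ∀ t₂ ∈ Set.Ioo (t₀ - ε) (t₀ + ε), t₁ < t₂ →
      riemannZeta (1/2 + t₁ * I) ≠ riemannZeta (1/2 + t₂ * I) := by
    intro t₁ ht₁ t₂ ht₂ hlt heq
    have hzero : ∀ t ∈ Set.Ioo (t₀ - ε) (t₀ + ε), riemannZeta (1/2 + t * I) = 0 → t = t₀ := by
      intro t ht hz
      refine hev ?_ hz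
      rw [Real.dist_eq, abs_lt]
      exact ⟨by linarith [ht.1], by linarith [ht.2]⟩
    have h0 : riemannZeta (1/2 + t₁ * I) ≠ 0 := fun h0 => by
      linarith [hzero t₁ ht₁ h0, hzero t₂ ht₂ (heq ▸ h0)]
    have h1 := im_mul_conj_Gammaℝ_eq_zero heq h0
    refine im_mul_conj_Gammaℝ_ne_zero (y₁ := t₁ / 2) (y₂ := t₂ / 2) (C := C) (by linarith) hc ?_ ?_ ?_
    · rw [lt_div_iff₀ (by positivity)] at hεC
      have : t₂ / 2 - t₁ / 2 ≤ ε := by linarith [ht₁.1, ht₂.2]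
      nlinarith
    · filter_upwards [h] with n hn y hy
      exact hn y ⟨by linarith [hy.1, ht₁.1], by linarith [hy.2, ht₂.2]⟩
    · rw [← h1]
      push_cast
      ring_nf
  refine ⟨ε, hε, fun t₁ ht₁ t₂ ht₂ heq => ?_⟩
  rcases lt_trichotomy t₁ t₂ with hlt | heq' | hlt
  · exact absurd heq (key t₁ ht₁ t₂ ht₂ hlt)
  · exact heq'
  · exact absurd heq.symm (key t₂ ht₂ t₁ ht₁ hlt)

/-- Euler–Maclaurin main term for `∑ k ≥ x, k ^ (-s)`, up to the sixth Bernoulli number. -/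
noncomputable def emMain (x : ℝ) (s : ℂ) : ℂ :=
  (x : ℂ) ^ (-s - 5) * ((x : ℂ) ^ 6 / (s - 1) + (x : ℂ) ^ 5 / 2 + s * (x : ℂ) ^ 4 / 12
    - s * (s + 1) * (s + 2) * (x : ℂ) ^ 2 / 720
    + s * (s + 1) * (s + 2) * (s + 3) * (s + 4) / 30240)

/-- Antiderivative, for `x ∈ [a, a + 1]`, of the Euler–Maclaurin remainder kernel. -/
noncomputable def emPrimitive (s : ℂ) (a x : ℝ) : ℂ :=
  (x : ℂ) ^ (-s - 5) * ((x : ℂ) ^ 6 / (s - 1) + (x - a - 1/2) * (x : ℂ) ^ 5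
    + ((x - a) ^ 2 - (x - a) + 1/6) / 2 * s * (x : ℂ) ^ 4
    + ((x - a) ^ 3 - 3/2 * (x - a) ^ 2 + (x - a) / 2) / 6 * (s * (s + 1)) * (x : ℂ) ^ 3
    + ((x - a) ^ 4 - 2 * (x - a) ^ 3 + (x - a) ^ 2 - 1/30) / 24
      * (s * (s + 1) * (s + 2)) * (x : ℂ) ^ 2
    + ((x - a) ^ 5 - 5/2 * (x - a) ^ 4 + 5/3 * (x - a) ^ 3 - (x - a) / 6) / 120
      * (s * (s + 1) * (s + 2) * (s + 3)) * (x : ℂ)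
    + ((x - a) ^ 6 - 3 * (x - a) ^ 5 + 5/2 * (x - a) ^ 4 - (x - a) ^ 2 / 2 + 1/42) / 720
      * (s * (s + 1) * (s + 2) * (s + 3) * (s + 4)))

lemma hasDerivAt_emPrimitive {s : ℂ} (hs : 0 ≤ s.re) (hs1 : s ≠ 1) (a : ℝ) {x : ℝ} (hx : 0 < x) :
    HasDerivAt (emPrimitive s a)
      (-((x : ℂ) ^ (-s - 6) * (s * (s + 1) * (s + 2) * (s + 3) * (s + 4) * (s + 5) / 720
        * ((((x - a) ^ 6 - 3 * (x - a) ^ 5 + 5/2 * (x - a) ^ 4 - (x - a) ^ 2 / 2 + 1/42 : ℝ)) : ℂ))))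
      x := by
  have hne : -s - 5 ≠ 0 := fun h => by
    have := congrArg re h
    simp at this
    linarith
  have hp := hasDerivAt_ofReal_cpow_const hx.ne' hne
  have hid : HasDerivAt (fun y : ℝ => (y : ℂ)) 1 x := (hasDerivAt_id x).ofReal_comp
  have hu : HasDerivAt (fun y : ℝ => (y : ℂ) - a) 1 x := hid.sub_const _
  have hQ := ((((((hid.pow 6).div_const (s - 1)).add ((hu.sub_const (1/2)).mul (hid.pow 5))).add
    ((((((hu.pow 2).sub hu).add_const (1/6)).div_const 2).mul_const s).mul (hid.pow 4))).add
    ((((((hu.pow 3).sub ((hu.pow 2).const_mul (3/2))).add (hu.div_const 2)).div_const 6).mul_const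
      (s * (s + 1))).mul (hid.pow 3))).add
    (((((((hu.pow 4).sub ((hu.pow 3).const_mul 2)).add (hu.pow 2)).sub_const (1/30)).div_const
      24).mul_const (s * (s + 1) * (s + 2))).mul (hid.pow 2))).add
    (((((((hu.pow 5).sub ((hu.pow 4).const_mul (5/2))).add ((hu.pow 3).const_mul (5/3))).sub
      (hu.div_const 6)).div_const 120).mul_const (s * (s + 1) * (s + 2) * (s + 3))).mul hid)
    |>.add ((((((((hu.pow 6).sub ((hu.pow 5).const_mul 3)).add ((hu.pow 4).const_mul (5/2))).sub
      ((hu.pow 2).div_const 2)).add_const (1/42))).div_const 720).mul_const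
        (s * (s + 1) * (s + 2) * (s + 3) * (s + 4)))
  have h := hp.mul hQ
  refine (h.congr_deriv ?_ : HasDerivAt _ _ x)
  have hx0 : (x : ℂ) ≠ 0 := by exact_mod_cast hx.ne'
  have hs1' : s - 1 ≠ 0 := sub_ne_zero.mpr hs1
  have e1 : (x : ℂ) ^ (-s - 5 - 1) = (x : ℂ) ^ (-s - 6) := by ring_nf
  have e2 : (x : ℂ) ^ (-s - 5) = (x : ℂ) ^ (-s - 6) * x := by
    rw [show -s - 5 = (-s - 6) + 1 by ring, cpow_add _ _ hx0, cpow_one]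
  rw [e1, e2]
  simp only [Pi.add_apply, Pi.sub_apply, Pi.mul_apply, Pi.pow_apply]
  push_cast
  field_simp
  ring

lemma abs_bernoulli_six_le {u : ℝ} (h0 : 0 ≤ u) (h1 : u ≤ 1) :
    |u ^ 6 - 3 * u ^ 5 + 5/2 * u ^ 4 - u ^ 2 / 2 + 1/42| ≤ 1/42 := by
  set v := u * (1 - u) with hv
  have hv0 : 0 ≤ v := mul_nonneg h0 (by linarith)
  have hv1 : v ≤ 1/4 := by nlinarith [sq_nonneg (u - 1/2)]
  have e : u ^ 6 - 3 * u ^ 5 + 5/2 * u ^ 4 - u ^ 2 / 2 + 1/42 = 1/42 - v ^ 2 / 2 - v ^ 3 := by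
    rw [hv]; ring
  have h2 : v ^ 2 ≤ 1/16 := by nlinarith
  have h3 : v ^ 3 ≤ 1/64 := by nlinarith [sq_nonneg v]
  have h4 : 0 ≤ v ^ 3 := by positivity
  rw [e, abs_le]
  constructor <;> nlinarith [sq_nonneg v]

lemma emPrimitive_left (s : ℂ) {a : ℝ} (ha : 0 < a) :
    emPrimitive s a a = emMain a s - (a : ℂ) ^ (-s) := by
  have ha0 : (a : ℂ) ≠ 0 := by exact_mod_cast ha.ne'
  have e : (a : ℂ) ^ (-s) = (a : ℂ) ^ (-s - 5) * (a : ℂ) ^ 5 := by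
    rw [← cpow_natCast, ← cpow_add _ _ ha0]
    push_cast
    ring_nf
  rw [emPrimitive, emMain, e]
  ring

lemma emPrimitive_right (s : ℂ) (a : ℝ) : emPrimitive s a (a + 1) = emMain (a + 1) s := by
  rw [emPrimitive, emMain]
  push_cast
  ring

lemma norm_emMain_sub_le {s : ℂ} (hs : 0 ≤ s.re) (hs1 : s ≠ 1) {a : ℝ} (ha : 1 ≤ a) :
    ‖emMain (a + 1) s - emMain a s + (a : ℂ) ^ (-s)‖
      ≤ ‖s * (s + 1) * (s + 2) * (s + 3) * (s + 4) * (s + 5)‖ / 151200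
        * (1 / a ^ 5 - 1 / (a + 1) ^ 5) := by
  set K := ‖s * (s + 1) * (s + 2) * (s + 3) * (s + 4) * (s + 5)‖ with hK
  have hpos : ∀ x ∈ Set.Icc a (a + 1), 0 < x := fun x hx => by linarith [hx.1]
  have hf := fun x hx => (hasDerivAt_emPrimitive hs hs1 a (hpos x hx)).sub_const (emPrimitive s a a)
  have hB : ∀ x ∈ Set.Icc a (a + 1), HasDerivAt (fun x : ℝ => K / 151200 * (1 / a ^ 5 - 1 / x ^ 5))
      (K / 30240 * (1 / x ^ 6)) x := fun x hx => by
    have hx0 := (hpos x hx).ne'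
    have := (((hasDerivAt_pow 5 x).inv (pow_ne_zero 5 hx0)).const_sub (1 / a ^ 5)).const_mul
      (K / 151200)
    simp only [one_div] at this ⊢
    refine this.congr_deriv ?_
    field_simp
    norm_num
    ring
  have h := image_norm_le_of_norm_deriv_right_le_deriv_boundary' (a := a) (b := a + 1)
    (f := fun x => emPrimitive s a x - emPrimitive s a a)
    (fun x hx => (hf x hx).continuousAt.continuousWithinAt)
    (fun x hx => (hf x (Set.Ico_subset_Icc_self hx)).hasDerivWithinAt) (by simp)
    (fun x hx => (hB x hx).continuousAt.continuousWithinAt)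
    (fun x hx => (hB x (Set.Ico_subset_Icc_self hx)).hasDerivWithinAt) ?_
    (Set.right_mem_Icc.mpr (by linarith))
  · rw [emPrimitive_left s (by linarith), emPrimitive_right] at h
    rw [sub_add]
    exact h
  · intro x hx
    have hx0 : 0 < x := hpos x (Set.Ico_subset_Icc_self hx)
    have hx1 : 1 ≤ x := by linarith [hx.1]
    rw [norm_neg, norm_mul, norm_mul, norm_div, norm_cpow_eq_rpow_re_of_pos hx0, norm_real,
      Real.norm_eq_abs, ← hK]
    have h1 : x ^ (-s - 6).re ≤ 1 / x ^ 6 := by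
      have : (1 / x ^ 6 : ℝ) = x ^ (-6 : ℝ) := by
        rw [Real.rpow_neg hx0.le, one_div]; norm_cast
      rw [this]
      refine Real.rpow_le_rpow_of_exponent_le hx1 ?_
      simp
      linarith
    have h2 := abs_bernoulli_six_le (u := x - a) (by linarith [hx.1]) (by linarith [hx.2])
    have h3 : ‖(720 : ℂ)‖ = 720 := by simp
    rw [h3]
    calc _ ≤ 1 / x ^ 6 * (K / 720 * (1/42)) := by gcongr
      _ = _ := by ring

lemma hasSum_inv_pow_five_sub :
    HasSum (fun n : ℕ => 1 / ((n : ℝ) + 2) ^ 5 - 1 / ((n : ℝ) + 2 + 1) ^ 5) (1/32) := by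
  rw [hasSum_iff_tendsto_nat_of_nonneg]
  · have e : ∀ n : ℕ, ∑ i ∈ Finset.range n, (1 / ((i : ℝ) + 2) ^ 5 - 1 / ((i : ℝ) + 2 + 1) ^ 5)
        = 1/32 - 1 / ((n : ℝ) + 2) ^ 5 := fun n => by
      have := Finset.sum_range_sub' (fun i : ℕ => (1 / ((i : ℝ) + 2) ^ 5 : ℝ)) n
      simp only [Nat.cast_zero, zero_add] at this
      rw [show (1/32 : ℝ) = 1 / 2 ^ 5 by norm_num, ← this]
      refine Finset.sum_congr rfl fun i _ => ?_
      push_cast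
      ring_nf
    simp_rw [e]
    have h1 : Filter.Tendsto (fun n : ℕ => (n : ℝ) + 2) Filter.atTop Filter.atTop :=
      Filter.tendsto_atTop_add_const_right Filter.atTop (2 : ℝ) tendsto_natCast_atTop_atTop
    have h2 := (tendsto_inv_atTop_zero.comp ((Filter.tendsto_pow_atTop (by norm_num : (5:ℕ) ≠ 0)).comp
      h1)).const_sub (1/32 : ℝ)
    simpa [Function.comp_def] using h2
  · intro n
    rw [sub_nonneg]
    exact one_div_le_one_div_of_le (by positivity) (pow_le_pow_left₀ (by positivity) (by linarith) 5)

lemma tendsto_emMain {s : ℂ} (hs : 1 < s.re) :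
    Filter.Tendsto (fun n : ℕ => emMain ((n : ℝ) + 2) s) Filter.atTop (nhds 0) := by
  have h1 : Filter.Tendsto (fun n : ℕ => (n : ℝ) + 2) Filter.atTop Filter.atTop :=
    Filter.tendsto_atTop_add_const_right Filter.atTop (2 : ℝ) tendsto_natCast_atTop_atTop
  have hz : ∀ k : ℕ, k ≤ 6 → Filter.Tendsto (fun n : ℕ => (((n : ℝ) + 2 : ℝ) : ℂ) ^ (-s - 5)
      * (((n : ℝ) + 2 : ℝ) : ℂ) ^ k) Filter.atTop (nhds 0) := fun k hk => by
    rw [tendsto_zero_iff_norm_tendsto_zero]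
    have h2 := (tendsto_rpow_neg_atTop (y := s.re + 5 - k) (by
      have : (k : ℝ) ≤ 6 := by exact_mod_cast hk
      linarith)).comp h1
    refine h2.congr fun n => ?_
    have hn : (0:ℝ) < (n : ℝ) + 2 := by positivity
    rw [norm_mul, norm_pow, norm_cpow_eq_rpow_re_of_pos hn, norm_real, Real.norm_of_nonneg hn.le,
      ← Real.rpow_natCast, ← Real.rpow_add hn]
    simp
    ring_nf
  have h := (((((hz 6 le_rfl).mul_const (1 / (s - 1))).add ((hz 5 (by norm_num)).mul_const (1/2))).add
    ((hz 4 (by norm_num)).mul_const (s / 12))).sub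
    ((hz 2 (by norm_num)).mul_const (s * (s + 1) * (s + 2) / 720))).add
    ((hz 0 (by norm_num)).mul_const (s * (s + 1) * (s + 2) * (s + 3) * (s + 4) / 30240))
  simp only [zero_mul, add_zero, sub_zero] at h
  refine h.congr fun n => ?_
  rw [emMain]
  ring

/-- The Euler–Maclaurin remainder on the interval `[n + 2, n + 3]`. -/
noncomputable def emRemainder (n : ℕ) (s : ℂ) : ℂ :=
  emMain ((n : ℝ) + 2 + 1) s - emMain ((n : ℝ) + 2) s + (((n : ℝ) + 2 : ℝ) : ℂ) ^ (-s)

lemma norm_emRemainder_le {s : ℂ} (hs : 0 ≤ s.re) (hs1 : s ≠ 1) (n : ℕ) :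
    ‖emRemainder n s‖ ≤ ‖s * (s + 1) * (s + 2) * (s + 3) * (s + 4) * (s + 5)‖ / 151200
        * (1 / ((n : ℝ) + 2) ^ 5 - 1 / ((n : ℝ) + 2 + 1) ^ 5) :=
  norm_emMain_sub_le hs hs1 (by linarith [(Nat.cast_nonneg n : (0:ℝ) ≤ n)])

lemma hasSum_emRemainder {s : ℂ} (hs : 1 < s.re) :
    HasSum (fun n => emRemainder n s) (riemannZeta s - 1 - emMain 2 s) := by
  have hs1 : s ≠ 1 := fun h => by simp [h] at hs
  have hsum : Summable (fun n => ‖emRemainder n s‖) :=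
    (hasSum_inv_pow_five_sub.mul_left _).summable.of_nonneg_of_le (fun _ => norm_nonneg _)
      (norm_emRemainder_le (by linarith) hs1)
  rw [hasSum_iff_tendsto_nat_of_summable_norm hsum]
  have hz : HasSum (fun n : ℕ => (((n : ℝ) + 2 : ℝ) : ℂ) ^ (-s)) (riemannZeta s - 1) := by
    have hS : Summable (fun n : ℕ => 1 / ((n : ℂ) + 1) ^ s) := by
      have := (summable_nat_add_iff 1).mpr (summable_one_div_nat_cpow.mpr hs)
      simpa using this
    have h1 : HasSum (fun n : ℕ => 1 / ((n : ℂ) + 1) ^ s) (riemannZeta s) := by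
      rw [zeta_eq_tsum_one_div_nat_add_one_cpow hs]
      exact hS.hasSum
    rw [← hasSum_nat_add_iff' 1] at h1
    simp only [Finset.sum_range_one, Nat.cast_zero, zero_add, one_cpow, div_one] at h1
    refine (congrArg (HasSum · (riemannZeta s - 1)) (funext fun n => ?_)).mp h1
    rw [cpow_neg, one_div]
    congr 2
    push_cast
    ring
  have hlim := ((tendsto_emMain hs).sub_const (emMain 2 s)).add hz.tendsto_sum_nat
  rw [show riemannZeta s - 1 - emMain 2 s = 0 - emMain 2 s + (riemannZeta s - 1) by ring]
  refine hlim.congr fun n => ?_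
  have := Finset.sum_range_sub (fun i : ℕ => emMain ((i : ℝ) + 2) s) n
  simp only [emRemainder, Finset.sum_add_distrib]
  congr 1
  simp only [Nat.cast_zero, zero_add] at this
  rw [← this]
  refine Finset.sum_congr rfl fun i _ => ?_
  push_cast
  ring_nf

lemma differentiableAt_emMain {x : ℝ} (hx : 0 < x) {s : ℂ} (hs : s ≠ 1) :
    DifferentiableAt ℂ (emMain x) s := by
  have hx0 : (x : ℂ) ≠ 0 := by exact_mod_cast hx.ne'
  have hs' : s - 1 ≠ 0 := sub_ne_zero.mpr hs
  have h1 : DifferentiableAt ℂ (fun s : ℂ => (x : ℂ) ^ (-s - 5)) s :=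
    DifferentiableAt.const_cpow (by fun_prop) (Or.inl hx0)
  unfold emMain
  fun_prop (disch := assumption)

lemma norm_riemannZeta_sub_le {s : ℂ} (h0 : 0 < s.re) (h1 : s.re < 3) (h2 : 0 < s.im)
    (h3 : s.im < 8) :
    ‖riemannZeta s - 1 - emMain 2 s‖
      ≤ ‖s * (s + 1) * (s + 2) * (s + 3) * (s + 4) * (s + 5)‖ / 4838400 := by
  set U : Set ℂ := Set.Ioo 0 3 ×ℂ Set.Ioo 0 8 with hU
  have hUo : IsOpen U := isOpen_Ioo.reProdIm isOpen_Ioo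
  have hUc : IsPreconnected U :=
    (((convex_Ioo (0:ℝ) 3).linear_preimage reLm).inter
      ((convex_Ioo (0:ℝ) 8).linear_preimage imLm)).isPreconnected
  have hU1 : ∀ w ∈ U, w ≠ 1 := fun w hw h => by
    have := hw.2.1
    simp [h] at this
  have hnorm : ∀ w ∈ U, ‖w‖ ≤ 11 := fun w hw => by
    refine (norm_le_abs_re_add_abs_im w).trans ?_
    rw [abs_of_pos hw.1.1, abs_of_pos hw.2.1]
    linarith [hw.1.2, hw.2.2]
  have hbound : ∀ (n : ℕ) (w : ℂ), w ∈ U → ‖emRemainder n w‖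
      ≤ 11 * 12 * 13 * 14 * 15 * 16 / 151200
        * (1 / ((n : ℝ) + 2) ^ 5 - 1 / ((n : ℝ) + 2 + 1) ^ 5) := fun n w hw => by
    refine (norm_emRemainder_le hw.1.1.le (hU1 w hw) n).trans ?_
    have hk : ∀ k : ℕ, ‖w + k‖ ≤ 11 + k := fun k =>
      (norm_add_le _ _).trans (by simpa using hnorm w hw)
    have ha := hk 1
    have hb := hk 2
    have hc := hk 3
    have hd := hk 4
    have he := hk 5
    norm_num at ha hb hc hd he
    have hpos : 0 ≤ 1 / ((n : ℝ) + 2) ^ 5 - 1 / ((n : ℝ) + 2 + 1) ^ 5 := by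
      rw [sub_nonneg]
      exact one_div_le_one_div_of_le (by positivity) (pow_le_pow_left₀ (by positivity) (by linarith) 5)
    simp only [norm_mul]
    gcongr
    exact hnorm w hw
  have hd1 : DifferentiableOn ℂ (fun w => ∑' n, emRemainder n w) U := by
    refine differentiableOn_tsum_of_summable_norm (hasSum_inv_pow_five_sub.mul_left _).summable
      (fun n w hw => DifferentiableAt.differentiableWithinAt ?_) hUo hbound
    have hn : (0:ℝ) < (n : ℝ) + 2 := by positivity
    unfold emRemainder
    refine ((differentiableAt_emMain (by positivity) (hU1 w hw)).sub
      (differentiableAt_emMain hn (hU1 w hw))).add ?_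
    exact DifferentiableAt.const_cpow (by fun_prop) (Or.inl (by exact_mod_cast hn.ne'))
  have hd2 : DifferentiableOn ℂ (fun w => riemannZeta w - 1 - emMain 2 w) U := fun w hw =>
    (((differentiableAt_riemannZeta (hU1 w hw)).sub_const 1).sub
      (differentiableAt_emMain (by norm_num) (hU1 w hw))).differentiableWithinAt
  have heq : Set.EqOn (fun w => ∑' n, emRemainder n w) (fun w => riemannZeta w - 1 - emMain 2 w) U := by
    refine (hd1.analyticOnNhd hUo).eqOn_of_preconnected_of_eventuallyEq (hd2.analyticOnNhd hUo) hUc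
      (z₀ := 2 + I) (by simp [hU, mem_reProdIm]; norm_num) ?_
    filter_upwards [(isOpen_lt continuous_const continuous_re).mem_nhds
      (show (1:ℝ) < (2 + I).re by simp)] with w hw
    exact (hasSum_emRemainder hw).tsum_eq
  have hsU : s ∈ U := ⟨⟨h0, h1⟩, ⟨h2, h3⟩⟩
  have e : riemannZeta s - 1 - emMain 2 s = ∑' n, emRemainder n s := (heq hsU).symm
  rw [e]
  have := tsum_of_norm_bounded (hasSum_inv_pow_five_sub.mul_left _)
    (norm_emRemainder_le h0.le (hU1 s hsU))
  refine this.trans (le_of_eq ?_)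
  ring

lemma hasDerivAt_emMain_two {s : ℂ} (hs : s ≠ 1) :
    HasDerivAt (emMain 2) ((2 : ℂ) ^ (-s - 5) *
      (-64 * (s - 1)⁻¹ ^ 2 + 4/3 - (3 * s ^ 2 + 6 * s + 2) / 180
        + (5 * s ^ 4 + 40 * s ^ 3 + 105 * s ^ 2 + 100 * s + 24) / 30240
        - (Real.log 2 : ℝ) * (64 * (s - 1)⁻¹ + 16 + 4/3 * s - (s ^ 3 + 3 * s ^ 2 + 2 * s) / 180
          + (s ^ 5 + 10 * s ^ 4 + 35 * s ^ 3 + 50 * s ^ 2 + 24 * s) / 30240))) s := by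
  have hs' : s - 1 ≠ 0 := sub_ne_zero.mpr hs
  have hid : HasDerivAt (fun w : ℂ => w) 1 s := hasDerivAt_id s
  have hn : HasDerivAt (fun w : ℂ => -w - 5) (-1) s := hid.neg.sub_const 5
  have hp := hn.const_cpow (c := 2) (Or.inl two_ne_zero)
  have hQ : HasDerivAt (fun w : ℂ => 64 * (w - 1)⁻¹ + 16 + 4/3 * w - (w ^ 3 + 3 * w ^ 2 + 2 * w) / 180
      + (w ^ 5 + 10 * w ^ 4 + 35 * w ^ 3 + 50 * w ^ 2 + 24 * w) / 30240) _ s :=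
    ((((((hid.sub_const 1).inv hs').const_mul 64).add_const 16).add (hid.const_mul (4/3))).sub
      ((((hasDerivAt_pow 3 s).add ((hasDerivAt_pow 2 s).const_mul 3)).add
        (hid.const_mul 2)).div_const 180)).add
      ((((((hasDerivAt_pow 5 s).add ((hasDerivAt_pow 4 s).const_mul 10)).add
        ((hasDerivAt_pow 3 s).const_mul 35)).add ((hasDerivAt_pow 2 s).const_mul 50)).add
        (hid.const_mul 24)).div_const 30240)
  have hfun : emMain 2 = (fun w : ℂ => (2 : ℂ) ^ (-w - 5)) *
      fun w : ℂ => 64 * (w - 1)⁻¹ + 16 + 4/3 * w - (w ^ 3 + 3 * w ^ 2 + 2 * w) / 180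
      + (w ^ 5 + 10 * w ^ 4 + 35 * w ^ 3 + 50 * w ^ 2 + 24 * w) / 30240 := by
    funext w
    simp only [emMain, Pi.mul_apply]
    push_cast
    ring
  rw [hfun]
  refine (hp.mul hQ).congr_deriv ?_
  rw [ofReal_log (by norm_num)]
  rw [neg_div, one_div, ← inv_pow]
  push_cast
  ring

lemma re_deriv_emMain_factor_le {t : ℝ} (h6 : 6 ≤ t) (h7 : t ≤ 32/5) {s : ℂ}
    (hs : s = 1/2 + t * I) :
    (-64 * (s - 1)⁻¹ ^ 2 + 4/3 - (3 * s ^ 2 + 6 * s + 2) / 180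
        + (5 * s ^ 4 + 40 * s ^ 3 + 105 * s ^ 2 + 100 * s + 24) / 30240
        - (Real.log 2 : ℝ) * (64 * (s - 1)⁻¹ + 16 + 4/3 * s - (s ^ 3 + 3 * s ^ 2 + 2 * s) / 180
          + (s ^ 5 + 10 * s ^ 4 + 35 * s ^ 3 + 50 * s ^ 2 + 24 * s) / 30240) : ℂ).re ≤ -8 := by
  obtain ⟨v, hv⟩ : ∃ v, v = t ^ 2 := ⟨_, rfl⟩
  have hv1 : 36 ≤ v := by rw [hv]; nlinarith
  have hv2 : v ≤ 1024/25 := by rw [hv]; nlinarith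
  obtain ⟨p, hp⟩ : ∃ p, p = (1/4 + v)⁻¹ := ⟨_, rfl⟩
  have hp0 : 0 < p := by rw [hp]; positivity
  have hpv : p * (1/4 + v) = 1 := by rw [hp]; exact inv_mul_cancel₀ (by positivity)
  have hinv : (s - 1)⁻¹ = ((-p / 2 : ℝ) : ℂ) + ((-p * t : ℝ) : ℂ) * I := by
    refine inv_eq_of_mul_eq_one_right ?_
    have : (p : ℂ) * (1/4 + t ^ 2) = 1 := by
      rw [hv] at hpv
      have h := congrArg ofReal hpv
      push_cast at h
      exact h
    rw [hs]
    push_cast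
    linear_combination this - (p * t ^ 2 : ℂ) * I_sq
  have hi1 : (s - 1)⁻¹.re = -p / 2 := by rw [hinv]; simp
  have hi2 : ((s - 1)⁻¹ ^ 2).re = p ^ 2 / 2 - p := by
    rw [hinv, show p ^ 2 / 2 - p = p ^ 2 / 2 - p * (p * (1/4 + v)) by rw [hpv, mul_one], hv]
    simp [pow_succ]
    ring
  have h1 : s.re = 1/2 := by rw [hs]; simp
  have h2 : (s ^ 2).re = 1/4 - v := by rw [hs, hv]; simp [pow_succ]; ring
  have h3 : (s ^ 3).re = 1/8 - 3/2 * v := by rw [hs, hv]; simp [pow_succ]; ring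
  have h4 : (s ^ 4).re = 1/16 - 3/2 * v + v ^ 2 := by rw [hs, hv]; simp [pow_succ]; ring
  have h5 : (s ^ 5).re = 1/32 - 5/4 * v + 5/2 * v ^ 2 := by rw [hs, hv]; simp [pow_succ]; ring
  have hc : (4 / 3 : ℂ) = ((4 / 3 : ℝ) : ℂ) := by push_cast; rfl
  rw [neg_mul, hc]
  simp only [sub_re, add_re, neg_re, ofReal_re, ofReal_im, div_ofNat_re, mul_re,
    re_ofNat, im_ofNat, zero_mul, sub_zero, hi1, hi2, h1, h2, h3, h4, h5]
  have hp1 : p ≤ (145/4 + 4121/100 - (1/4 + v)) / (145/4 * (4121/100)) := by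
    rw [le_div_iff₀ (by norm_num)]
    have := mul_nonneg hp0.le (mul_nonneg (sub_nonneg.mpr (show 145/4 ≤ 1/4 + v by linarith))
      (sub_nonneg.mpr (show 1/4 + v ≤ 4121/100 by linarith)))
    nlinarith
  have hL1 := Real.log_two_gt_d9
  have hL2 := Real.log_two_lt_d9
  obtain ⟨q, hq⟩ : ∃ q, q = 64 * (-p / 2) + 16 + 4/3 * (1/2)
      - (1/8 - 3/2 * v + 3 * (1/4 - v) + 2 * (1/2)) / 180
      + (1/32 - 5/4 * v + 5/2 * v ^ 2 + 10 * (1/16 - 3/2 * v + v ^ 2) + 35 * (1/8 - 3/2 * v)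
        + 50 * (1/4 - v) + 24 * (1/2)) / 30240 := ⟨_, rfl⟩
  have hq0 : 0 ≤ q := by rw [hq]; nlinarith
  have hq1 : 6931/10000 * q ≤ Real.log 2 * q := by gcongr; linarith
  rw [← hq]
  nlinarith

lemma deriv_riemannZeta_ne_zero {t : ℝ} (h6 : 6 ≤ t) (h7 : t ≤ 32/5) :
    deriv riemannZeta (1/2 + t * I) ≠ 0 := by
  obtain ⟨s, hs⟩ : ∃ s : ℂ, s = 1/2 + t * I := ⟨_, rfl⟩
  rw [← hs]
  have hre : s.re = 1/2 := by rw [hs]; simp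
  have him : s.im = t := by rw [hs]; simp
  have hball : ∀ w ∈ Metric.closedBall s (2/5), 1/10 ≤ w.re ∧ w.re ≤ 9/10 ∧ 28/5 ≤ w.im ∧
      w.im ≤ 34/5 := fun w hw => by
    rw [Metric.mem_closedBall, dist_eq_norm] at hw
    have h1 := abs_le.mp ((abs_re_le_norm _).trans hw)
    have h2 := abs_le.mp ((abs_im_le_norm _).trans hw)
    rw [sub_re, hre] at h1
    rw [sub_im, him] at h2
    refine ⟨?_, ?_, ?_, ?_⟩ <;> linarith
  have hne : ∀ w ∈ Metric.closedBall s (2/5), w ≠ 1 := fun w hw h => by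
    have := (hball w hw).2.1
    rw [h, one_re] at this
    norm_num at this
  have hs1 : s ≠ 1 := hne s (Metric.mem_closedBall_self (by norm_num))
  have hshift : ∀ w ∈ Metric.closedBall s (2/5), ∀ (k : ℕ) (c : ℝ), 0 ≤ c →
      (k + 1/2) ^ 2 + (32/5) ^ 2 ≤ c ^ 2 → ‖w + k‖ ≤ c + 2/5 := fun w hw k c hc hk => by
    rw [Metric.mem_closedBall, dist_eq_norm] at hw
    have h1 : ‖s + k‖ ≤ c := by
      refine abs_le_of_sq_le_sq' ?_ hc |>.2
      rw [← normSq_eq_norm_sq, normSq_apply]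
      simp only [add_re, add_im, natCast_re, natCast_im, hre, him]
      nlinarith
    calc ‖w + k‖ = ‖(s + k) + (w - s)‖ := by congr 1; ring
      _ ≤ _ := (norm_add_le _ _).trans (add_le_add h1 hw)
  have hR : ∀ w ∈ Metric.sphere s (2/5), ‖riemannZeta w - 1 - emMain 2 w‖ ≤ 1/24 := fun w hw => by
    have hw' := Metric.sphere_subset_closedBall hw
    obtain ⟨h1, h2, h3, h4⟩ := hball w hw'
    refine (norm_riemannZeta_sub_le (by linarith) (by linarith) (by linarith) (by linarith)).trans ?_
    have k0 := hshift w hw' 0 (642/100) (by norm_num) (by norm_num)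
    have k1 := hshift w hw' 1 (658/100) (by norm_num) (by norm_num)
    have k2 := hshift w hw' 2 (688/100) (by norm_num) (by norm_num)
    have k3 := hshift w hw' 3 (73/10) (by norm_num) (by norm_num)
    have k4 := hshift w hw' 4 (783/100) (by norm_num) (by norm_num)
    have k5 := hshift w hw' 5 (844/100) (by norm_num) (by norm_num)
    norm_num at k0 k1 k2 k3 k4 k5
    rw [div_le_iff₀ (by norm_num)]
    simp only [norm_mul]
    calc _ ≤ (341/50 : ℝ) * (349/50) * (182/25) * (77/10) * (823/100) * (221/25) := by gcongr
      _ ≤ _ := by norm_num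
  have hmain := hasDerivAt_emMain_two hs1
  have hz := (differentiableAt_riemannZeta hs1).hasDerivAt
  have hcauchy : ‖deriv (fun w => riemannZeta w - 1 - emMain 2 w) s‖ ≤ 1/24 / (2/5) := by
    refine norm_deriv_le_of_forall_mem_sphere_norm_le (by norm_num) ?_ hR
    refine DifferentiableOn.diffContOnCl fun w hw => DifferentiableAt.differentiableWithinAt ?_
    have hw1 := hne w (Metric.closure_ball_subset_closedBall hw)
    exact ((differentiableAt_riemannZeta hw1).sub_const 1).sub
      (differentiableAt_emMain (by norm_num) hw1)
  have hdiff : HasDerivAt (fun w => riemannZeta w - 1 - emMain 2 w) _ s := (hz.sub_const 1).sub hmain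
  rw [hdiff.deriv] at hcauchy
  intro h0
  rw [h0, zero_sub, norm_neg, norm_mul] at hcauchy
  have hfac := re_deriv_emMain_factor_le h6 h7 hs
  have hfac' := (neg_le_neg hfac).trans ((neg_le_abs _).trans (abs_re_le_norm _))
  have hpow : (1/46 : ℝ) ≤ ‖(2 : ℂ) ^ (-s - 5)‖ := by
    have h : ‖(2 : ℂ) ^ (-s - 5)‖ = (2 : ℝ) ^ (-(11/2) : ℝ) := by
      have := norm_cpow_eq_rpow_re_of_pos (show (0:ℝ) < 2 by norm_num) (-s - 5)
      rw [ofReal_ofNat] at this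
      rw [this]
      congr 1
      simp [hre]
      norm_num
    rw [h]
    refine abs_le_of_sq_le_sq' ?_ (by positivity) |>.2
    rw [← Real.rpow_natCast, ← Real.rpow_natCast, ← Real.rpow_mul (by norm_num)]
    norm_num
  have := mul_le_mul hpow hfac' (by norm_num) (norm_nonneg _)
  norm_num at this hcauchy
  linarith

/-- A function with nonzero strict derivative is injective near the point. -/
lemma HasStrictDerivAt.exists_mem_nhds_injOn {f : ℂ → ℂ} {f' z : ℂ} (h : HasStrictDerivAt f f' z)
    (hf' : f' ≠ 0) : ∃ u ∈ nhds z, Set.InjOn f u :=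
  ⟨_, (h.hasStrictFDerivAt_equiv hf').toOpenPartialHomeomorph f |>.open_source.mem_nhds
    (h.hasStrictFDerivAt_equiv hf').mem_toOpenPartialHomeomorph_source,
    ((h.hasStrictFDerivAt_equiv hf').toOpenPartialHomeomorph f).injOn⟩

lemma exists_injOn_of_deriv_riemannZeta_ne_zero {t₀ : ℝ}
    (h : deriv riemannZeta (1/2 + t₀ * I) ≠ 0) :
    ∃ ε > 0, Set.InjOn (fun t : ℝ => riemannZeta (1/2 + t * I)) (Set.Ioo (t₀ - ε) (t₀ + ε)) := by
  have hne : (1/2 + t₀ * I : ℂ) ≠ 1 := fun h => by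
    have := congrArg re h
    norm_num at this
  have han : AnalyticAt ℂ riemannZeta (1/2 + t₀ * I) := by
    refine (DifferentiableOn.analyticOnNhd (s := {1}ᶜ) (fun w hw =>
      (differentiableAt_riemannZeta hw).differentiableWithinAt) isOpen_compl_singleton) _ hne
  obtain ⟨u, hu, hinj⟩ := han.hasStrictDerivAt.exists_mem_nhds_injOn h
  have hcont : ContinuousAt (fun t : ℝ => (1/2 + t * I : ℂ)) t₀ := by fun_prop
  obtain ⟨ε, hε, hsub⟩ := Metric.mem_nhds_iff.mp (hcont hu)
  refine ⟨ε, hε, fun x hx y hy hxy => ?_⟩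
  rw [← Real.ball_eq_Ioo] at hx hy
  have := hinj (hsub hx) (hsub hy) hxy
  simpa using this

lemma riemannZeta_half_neg (t : ℝ) :
    riemannZeta (1/2 + (-t : ℝ) * I) = (starRingEnd ℂ) (riemannZeta (1/2 + t * I)) := by
  rw [← riemannZeta_conj]
  congr 1
  simp [conj_ofNat]

theorem zeta_critical_line_locally_injective :
    ∀ t₀ : ℝ, ∃ ε > (0:ℝ), Set.InjOn (fun t : ℝ => riemannZeta (1/2 + t * I))
      (Set.Ioo (t₀ - ε) (t₀ + ε)) := by
  have hpos : ∀ t₀ : ℝ, 0 ≤ t₀ → ∃ ε > (0:ℝ), Set.InjOn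
      (fun t : ℝ => riemannZeta (1/2 + t * I)) (Set.Ioo (t₀ - ε) (t₀ + ε)) := by
    intro t₀ h0
    rcases lt_or_ge t₀ 6 with h | h
    · obtain ⟨c, hc, C, hC⟩ := phaseDeriv_bounds_of_lt_three
      refine exists_injOn_of_phaseDeriv_bounds (sub_pos.mpr h) hc
        (hC.mono fun n hn y hy => hn y (abs_lt.mpr ⟨?_, ?_⟩)) <;> linarith [hy.1, hy.2]
    rcases le_or_gt t₀ (32/5) with h' | h'
    · exact exists_injOn_of_deriv_riemannZeta_ne_zero (deriv_riemannZeta_ne_zero h h')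
    · obtain ⟨c, hc, C, hC⟩ := phaseDeriv_bounds_of_gt t₀
      refine exists_injOn_of_phaseDeriv_bounds (sub_pos.mpr h') hc
        (hC.mono fun n hn y hy => hn y ⟨?_, ?_⟩) <;> linarith [hy.1, hy.2]
  intro t₀
  rcases le_total 0 t₀ with h | h
  · exact hpos t₀ h
  · obtain ⟨ε, hε, hinj⟩ := hpos (-t₀) (neg_nonneg.mpr h)
    refine ⟨ε, hε, fun x hx y hy hxy => ?_⟩
    refine neg_injective (hinj ?_ ?_ ?_)
    · constructor <;> linarith [hx.1, hx.2]
    · constructor <;> linarith [hy.1, hy.2]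
    · have := congrArg (starRingEnd ℂ) hxy
      simpa only [← riemannZeta_half_neg] using this
end
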